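/- arXiv:1811.09223 — 2 statements merged into one kernel-verified Lean document; each statement's English description precedes it below -/
import Mathlib

section
/- There exists a natural number D and an absolute constant K ≥ 1 such that for every real ε with 0 < ε ≤ 1/2 there exist a map Φ: H → ℝ^D and a constant c > 0 satisfying c·d(p,p')^{1−ε} ≤ |Φ(p) − Φ(p')| ≤ c·K·ε^{−1/2}·d(p,p')^{1−ε} for all p, p' ∈ H. In other words, the snowflaked metric space (H, d^{1−ε}) admits an embedding into ℝ^D with distortion O(ε^{−1/2}), with D independent of ε. -/
open scoped ENNReal NNReal RealInnerProductSpace BigOperators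

noncomputable section

/-- The Heisenberg group `H`, identified as a set with `ℝ³`. -/
abbrev H : Type := ℝ × ℝ × ℝ

namespace Heisenberg

/-- The group law `[a,b,c]·[x,y,z] = [x+a, y+b, z+c+a·y]`. -/
def mul (p q : H) : H := (q.1 + p.1, q.2.1 + p.2.1, q.2.2 + p.2.2 + p.1 * q.2.1)

/-- The group inverse `[x,y,z]⁻¹ = [−x,−y,−z+xy]`. -/
def inv (p : H) : H := (-p.1, -p.2.1, -p.2.2 + p.1 * p.2.1)

/-- Membership in the integer lattice `Γ`. -/
def inGamma (p : H) : Prop :=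
  (∃ a : ℤ, p.1 = (a : ℝ)) ∧ (∃ b : ℤ, p.2.1 = (b : ℝ)) ∧ (∃ c : ℤ, p.2.2 = (c : ℝ))

/-- Flow along the vector field `X`: `exp(tX)[x,y,z] = [x+t, y, z+t·y]`. -/
def flowX (t : ℝ) (p : H) : H := (p.1 + t, p.2.1, p.2.2 + t * p.2.1)

/-- Flow along the vector field `Y`: `exp(tY)[x,y,z] = [x, y+t, z]`. -/
def flowY (t : ℝ) (p : H) : H := (p.1, p.2.1 + t, p.2.2)

def flow : Bool → ℝ → H → H
  | true => flowX
  | false => flowY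

/-- `applyFlows [(W₁,t₁),…,(W_k,t_k)] p = exp(t₁W₁)⋯exp(t_kW_k) p`. -/
def applyFlows : List (Bool × ℝ) → H → H
  | [], p => p
  | wt :: l, p => flow wt.1 wt.2 (applyFlows l p)

/-- The Carnot–Carathéodory metric on `H`. -/
def ccDist (p p' : H) : ℝ :=
  sInf { s | ∃ l : List (Bool × ℝ), applyFlows l p = p' ∧ s = (l.map fun wt => |wt.2|).sum }

/-- The parabolic dilation `δ_λ[x,y,z] = [λx, λy, λ²z]`. -/
def dilate (lam : ℝ) (p : H) : H := (lam * p.1, lam * p.2.1, lam ^ 2 * p.2.2)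

variable {E : Type*} [NormedAddCommGroup E] [NormedSpace ℝ E]

/-- The right-invariant vector field `X = ∂/∂x + y ∂/∂z` acting on functions. -/
def XD (φ : H → E) : H → E := fun p => fderiv ℝ φ p (1, 0, p.2.1)

/-- The right-invariant vector field `Y = ∂/∂y` acting on functions. -/
def YD (φ : H → E) : H → E := fun p => fderiv ℝ φ p (0, 1, 0)

/-- The vector field `Z = ∂/∂z` acting on functions. -/
def ZD (φ : H → E) : H → E := fun p => fderiv ℝ φ p (0, 0, 1)

def WD : Bool → (H → E) → H → E
  | true => XD
  | false => YD

/-- `X`, `Y`, `Z` indexed by `Fin 3`. -/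
def WD3 : Fin 3 → (H → E) → H → E := ![XD, YD, ZD]

/-- The pointwise (Euclidean) norm `|∇^j φ(p)|` of the `j`-th iterated horizontal
gradient `∇^jφ`, computed via the words of length `j` in `X, Y`. -/
def gradNorm (j : ℕ) (φ : H → E) (p : H) : ℝ :=
  Real.sqrt (∑ w : Fin j → Bool, ‖(List.ofFn w).foldr WD φ p‖ ^ 2)

/-- `‖∇^m φ‖_{C^k_R}`, valued in `ℝ≥0∞`. -/
def CkRS (m k : ℕ) (R : ℝ) (φ : H → E) : ℝ≥0∞ :=
  ∑ j ∈ Finset.range (k + 1),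
    ENNReal.ofReal (R ^ j) * ⨆ p : H, ENNReal.ofReal (gradNorm (m + j) φ p)

/-- The homogeneous Hölder seminorm `‖∇^m φ‖_{Ċ^{0,α}}`, valued in `ℝ≥0∞`. -/
def gradHolderS (m : ℕ) (α : ℝ) (φ : H → E) : ℝ≥0∞ :=
  ⨆ (p : H) (q : H) (_ : p ≠ q),
    ENNReal.ofReal (Real.sqrt (∑ w : Fin m → Bool,
        ‖(List.ofFn w).foldr WD φ p - (List.ofFn w).foldr WD φ q‖ ^ 2)) /
      ENNReal.ofReal (ccDist p q ^ α)

/-- `‖∇^m φ‖_{C^{k,α}_R}`, valued in `ℝ≥0∞`. -/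
def CkAS (m k : ℕ) (α R : ℝ) (φ : H → E) : ℝ≥0∞ :=
  CkRS m k R φ + ENNReal.ofReal (R ^ ((k : ℝ) + α)) * gradHolderS (m + k) α φ

/-- `‖φ‖_{C^k_R}`. -/
abbrev CkR (k : ℕ) (R : ℝ) (φ : H → E) : ℝ≥0∞ := CkRS 0 k R φ

/-- `‖φ‖_{C^{k,α}_R}`. -/
abbrev CkA (k : ℕ) (α R : ℝ) (φ : H → E) : ℝ≥0∞ := CkAS 0 k α R φ

/-- A dyadic number is one of the form `2^m`, `m ∈ ℤ`. -/
def IsDyadic (A : ℝ) : Prop := ∃ m : ℤ, A = 2 ^ m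

/-- The norm `|v₁ ∧ ⋯ ∧ v_k|` of a wedge product of vectors of `ℝ^D`, via the
Cauchy–Binet (Gram determinant) formula. -/
def wedgeNorm {D k : ℕ} (v : Fin k → EuclideanSpace ℝ (Fin D)) : ℝ :=
  Real.sqrt (Matrix.det (Matrix.of fun i j => ⟪v i, v j⟫))

end Heisenberg

open Heisenberg

namespace Heisenberg

/-- Total length of a horizontal path. -/
def pathLength (l : List (Bool × ℝ)) : ℝ := (l.map fun wt => |wt.2|).sum

@[simp] lemma pathLength_nil : pathLength [] = 0 := rfl

@[simp] lemma pathLength_cons (wt : Bool × ℝ) (l : List (Bool × ℝ)) :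
    pathLength (wt :: l) = |wt.2| + pathLength l := by
  simp [pathLength]

lemma pathLength_nonneg (l : List (Bool × ℝ)) : 0 ≤ pathLength l := by
  induction l with
  | nil => simp
  | cons wt l ih => rw [pathLength_cons]; positivity

lemma pathLength_append (l l' : List (Bool × ℝ)) :
    pathLength (l ++ l') = pathLength l + pathLength l' := by
  simp [pathLength]

lemma applyFlows_append (l l' : List (Bool × ℝ)) (p : H) :
    applyFlows (l ++ l') p = applyFlows l (applyFlows l' p) := by
  induction l with
  | nil => rfl
  | cons wt l ih => simp [applyFlows, ih]

/-- The right quotient `p · g⁻¹`. -/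
def rel (p g : H) : H :=
  (p.1 - g.1, p.2.1 - g.2.1, p.2.2 - g.2.2 + g.1 * g.2.1 - p.1 * g.2.1)

lemma rel_flow (W : Bool) (t : ℝ) (p g : H) : rel (flow W t p) g = flow W t (rel p g) := by
  cases W <;> ext <;> simp [rel, flow, flowX, flowY] <;> ring

lemma rel_applyFlows (l : List (Bool × ℝ)) (p g : H) :
    rel (applyFlows l p) g = applyFlows l (rel p g) := by
  induction l with
  | nil => rfl
  | cons wt l ih => simp [applyFlows, rel_flow, ih]

lemma rel_self (p : H) : rel p p = 0 := by
  ext <;> simp [rel]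

lemma rel_left_injective {p q g : H} (h : rel p g = rel q g) : p = q := by
  simp only [rel, Prod.mk.injEq] at h
  obtain ⟨h1, h2, h3⟩ := h
  have e1 : p.1 = q.1 := by linarith
  have e2 : p.2.1 = q.2.1 := by linarith
  rw [e1] at h3
  exact Prod.ext e1 (Prod.ext e2 (by linarith))

lemma flow_add (W : Bool) (s t : ℝ) (p : H) : flow W (t + s) p = flow W s (flow W t p) := by
  cases W <;> ext <;> simp [flow, flowX, flowY] <;> ring

lemma flow_zero (W : Bool) (p : H) : flow W 0 p = p := by
  cases W <;> ext <;> simp [flow, flowX, flowY]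

lemma flow_neg_flow (W : Bool) (t : ℝ) (p : H) : flow W (-t) (flow W t p) = p := by
  rw [← flow_add, add_neg_cancel, flow_zero]

lemma dilate_flow (lam : ℝ) (W : Bool) (t : ℝ) (p : H) :
    dilate lam (flow W t p) = flow W (lam * t) (dilate lam p) := by
  cases W <;> ext <;> simp [dilate, flow, flowX, flowY] <;> ring

lemma dilate_dilate (a b : ℝ) (p : H) : dilate a (dilate b p) = dilate (a * b) p := by
  ext <;> simp [dilate] <;> ring

lemma dilate_one (p : H) : dilate 1 p = p := by
  ext <;> simp [dilate]

/-- The coordinate box of radius `r`. -/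
def box (r : ℝ) : Set H := {p | |p.1| ≤ r ∧ |p.2.1| ≤ r ∧ |p.2.2| ≤ r}

lemma box_mono {r s : ℝ} (h : r ≤ s) : box r ⊆ box s := fun _ hp =>
  ⟨hp.1.trans h, hp.2.1.trans h, hp.2.2.trans h⟩

lemma exists_path_zero (q : H) : ∃ l, applyFlows l 0 = q ∧
    pathLength l ≤ |q.1| + |q.2.1| + 2 + 2 * |q.2.2 - q.1 * q.2.1| := by
  set w := q.2.2 - q.1 * q.2.1 with hw
  refine ⟨[(true, -w), (false, -1), (true, w), (false, 1), (true, q.1), (false, q.2.1)], ?_, ?_⟩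
  · ext <;> simp [applyFlows, flow, flowX, flowY]
    rw [hw]; ring
  · simp
    linarith

lemma exists_path_of_rel_mem_box {r : ℝ} {p g : H} (h : rel p g ∈ box r) :
    ∃ l, applyFlows l g = p ∧ pathLength l ≤ 4 * r + 2 + 2 * r ^ 2 := by
  obtain ⟨l, hl, hl'⟩ := exists_path_zero (rel p g)
  refine ⟨l, rel_left_injective (g := g) (by rw [rel_applyFlows, rel_self, hl]), hl'.trans ?_⟩
  obtain ⟨h1, h2, h3⟩ := h
  have h4 : |(rel p g).2.2 - (rel p g).1 * (rel p g).2.1| ≤ r + r * r :=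
    (abs_sub _ _).trans (add_le_add h3 (by
      rw [abs_mul]
      exact mul_le_mul h1 h2 (abs_nonneg _) ((abs_nonneg _).trans h1)))
  nlinarith

lemma exists_path (p p' : H) : ∃ l, applyFlows l p = p' := by
  obtain ⟨l, hl, -⟩ := exists_path_zero (rel p' p)
  exact ⟨l, rel_left_injective (g := p) (by rw [rel_applyFlows, rel_self, hl])⟩

lemma ccDist_le {l : List (Bool × ℝ)} {p p' : H} (h : applyFlows l p = p') :
    ccDist p p' ≤ pathLength l :=
  csInf_le ⟨0, by rintro _ ⟨l, -, rfl⟩; exact pathLength_nonneg l⟩ ⟨l, h, rfl⟩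

lemma ccDist_nonneg (p p' : H) : 0 ≤ ccDist p p' :=
  Real.sInf_nonneg (by rintro _ ⟨l, -, rfl⟩; exact pathLength_nonneg l)

lemma exists_path_lt {p p' : H} {r : ℝ} (h : ccDist p p' < r) :
    ∃ l, applyFlows l p = p' ∧ pathLength l < r := by
  obtain ⟨l, hl⟩ := exists_path p p'
  obtain ⟨_, ⟨l, hl, rfl⟩, hr⟩ := exists_lt_of_csInf_lt (s := { s | ∃ l : List (Bool × ℝ),
    applyFlows l p = p' ∧ s = (l.map fun wt => |wt.2|).sum }) ⟨_, l, hl, rfl⟩ h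
  exact ⟨l, hl, hr⟩

lemma ccDist_self (p : H) : ccDist p p = 0 :=
  le_antisymm (ccDist_le (l := []) rfl) (ccDist_nonneg p p)

lemma applyFlows_zero_bound (l : List (Bool × ℝ)) :
    |(applyFlows l 0).1| ≤ pathLength l ∧ |(applyFlows l 0).2.1| ≤ pathLength l ∧
      |(applyFlows l 0).2.2| ≤ pathLength l ^ 2 := by
  induction l with
  | nil => simp [applyFlows]
  | cons wt l ih =>
    obtain ⟨W, t⟩ := wt
    obtain ⟨h1, h2, h3⟩ := ih
    have h0 := pathLength_nonneg l
    have ht := abs_nonneg t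
    simp only [applyFlows, pathLength_cons]
    cases W <;> simp only [flow, flowX, flowY]
    · refine ⟨by linarith, (abs_add_le _ _).trans (by linarith), by nlinarith⟩
    · refine ⟨(abs_add_le _ _).trans (by linarith), by linarith, (abs_add_le _ _).trans ?_⟩
      rw [abs_mul]
      nlinarith [mul_le_mul_of_nonneg_left h2 ht]

lemma rel_mem_box_of_path {l : List (Bool × ℝ)} {p g : H} (h : applyFlows l g = p) {r : ℝ}
    (hr : 1 ≤ r) (hl : pathLength l ≤ r) : rel p g ∈ box (r ^ 2) := by
  obtain ⟨h1, h2, h3⟩ := applyFlows_zero_bound l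
  rw [← h, rel_applyFlows, rel_self]
  have := pathLength_nonneg l
  exact ⟨by nlinarith, by nlinarith, by nlinarith⟩

lemma ccDist_pos {p p' : H} (h : p ≠ p') : 0 < ccDist p p' := by
  refine (ccDist_nonneg p p').lt_of_ne fun h0 => h ?_
  have key : ∀ r : ℝ, 0 < r → |(rel p' p).1| ≤ r ∧ |(rel p' p).2.1| ≤ r ∧
      |(rel p' p).2.2| ≤ r ^ 2 := by
    intro r hr
    obtain ⟨l, hl, hlr⟩ := exists_path_lt (h0 ▸ hr : ccDist p p' < r)
    obtain ⟨h1, h2, h3⟩ := applyFlows_zero_bound l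
    rw [← hl, rel_applyFlows, rel_self]
    have := pathLength_nonneg l
    exact ⟨by linarith, by linarith, by nlinarith⟩
  have e1 : (rel p' p).1 = 0 :=
    abs_nonpos_iff.1 (le_of_forall_pos_le_add fun r hr => by simpa using (key r hr).1)
  have e2 : (rel p' p).2.1 = 0 :=
    abs_nonpos_iff.1 (le_of_forall_pos_le_add fun r hr => by simpa using (key r hr).2.1)
  have e3 : (rel p' p).2.2 = 0 :=
    abs_nonpos_iff.1 (le_of_forall_pos_le_add fun r hr => by
      have := (key (√r) (Real.sqrt_pos.2 hr)).2.2
      rw [Real.sq_sqrt hr.le] at this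
      simpa using this)
  exact (rel_left_injective (g := p) (by rw [rel_self]; exact Prod.ext e1 (Prod.ext e2 e3))).symm

lemma dilate_applyFlows (lam : ℝ) (l : List (Bool × ℝ)) (p : H) :
    dilate lam (applyFlows l p) =
      applyFlows (l.map fun wt => (wt.1, lam * wt.2)) (dilate lam p) := by
  induction l with
  | nil => rfl
  | cons wt l ih => simp [applyFlows, dilate_flow, ih]

lemma pathLength_map_mul {lam : ℝ} (h : 0 ≤ lam) (l : List (Bool × ℝ)) :
    pathLength (l.map fun wt => (wt.1, lam * wt.2)) = lam * pathLength l := by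
  induction l with
  | nil => simp
  | cons wt l ih => simp [ih, abs_mul, abs_of_nonneg h, mul_add]

lemma ccDist_dilate_le {lam : ℝ} (h : 0 < lam) (p p' : H) :
    ccDist (dilate lam p) (dilate lam p') ≤ lam * ccDist p p' := by
  rw [← div_le_iff₀' h]
  obtain ⟨l, hl⟩ := exists_path p p'
  refine le_csInf ⟨_, l, hl, rfl⟩ ?_
  rintro _ ⟨l, hl, rfl⟩
  rw [div_le_iff₀' h]
  refine (ccDist_le (l := l.map fun wt => (wt.1, lam * wt.2)) ?_).trans_eq
    (pathLength_map_mul h.le l)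
  rw [← dilate_applyFlows, hl]

lemma ccDist_dilate {lam : ℝ} (h : 0 < lam) (p p' : H) :
    ccDist (dilate lam p) (dilate lam p') = lam * ccDist p p' := by
  refine (ccDist_dilate_le h p p').antisymm ?_
  have := ccDist_dilate_le (inv_pos.2 h) (dilate lam p) (dilate lam p')
  rwa [dilate_dilate, dilate_dilate, inv_mul_cancel₀ h.ne', dilate_one, dilate_one,
    le_inv_mul_iff₀ h] at this

section FlowLipschitz

variable {E : Type*} [NormedAddCommGroup E]

/-- `f` is `C`-Lipschitz along the horizontal flows. -/
def FlowLipschitz (C : ℝ) (f : H → E) : Prop :=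
  ∀ W t p, ‖f (flow W t p) - f p‖ ≤ C * |t|

lemma FlowLipschitz.norm_applyFlows_sub_le {f : H → E} {C : ℝ} (h : FlowLipschitz C f)
    (l : List (Bool × ℝ)) (p : H) : ‖f (applyFlows l p) - f p‖ ≤ C * pathLength l := by
  induction l with
  | nil => simp [applyFlows]
  | cons wt l ih =>
    rw [pathLength_cons, applyFlows, mul_add]
    exact (norm_sub_le_norm_sub_add_norm_sub _ (f (applyFlows l p)) _).trans
      (add_le_add (h _ _ _) ih)

lemma FlowLipschitz.norm_sub_le {f : H → E} {C : ℝ} (h : FlowLipschitz C f) (hC : 0 ≤ C)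
    (p p' : H) : ‖f p - f p'‖ ≤ C * ccDist p p' := by
  rw [norm_sub_rev]
  refine le_of_forall_pos_le_add fun r hr => ?_
  obtain ⟨l, hl, hlr⟩ := exists_path_lt (p := p) (p' := p')
    (lt_add_of_pos_right _ (show 0 < r / (C + 1) by positivity))
  rw [← hl] at *
  refine (h.norm_applyFlows_sub_le l p).trans ((mul_le_mul_of_nonneg_left hlr.le hC).trans ?_)
  rw [mul_add]
  gcongr
  rw [mul_div_left_comm]
  exact mul_le_of_le_one_right hr.le ((div_le_one (by positivity)).2 (by linarith))

lemma FlowLipschitz.add {f g : H → E} {C C' : ℝ} (hf : FlowLipschitz C f)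
    (hg : FlowLipschitz C' g) : FlowLipschitz (C + C') (fun p => f p + g p) := fun W t p => by
  rw [add_sub_add_comm, add_mul]
  exact (norm_add_le _ _).trans (add_le_add (hf W t p) (hg W t p))

end FlowLipschitz

section HorizontalDerivative

variable {E : Type*} [NormedAddCommGroup E] [NormedSpace ℝ E]

/-- `f'` is the horizontal gradient of `f`: `f' true = Xf` and `f' false = Yf`. -/
def HasHorizDeriv (f : H → E) (f' : Bool → H → E) : Prop :=
  ∀ W p, HasDerivAt (fun t => f (flow W t p)) (f' W p) 0

lemma HasHorizDeriv.hasDerivAt {f : H → E} {f' : Bool → H → E} (h : HasHorizDeriv f f')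
    (W : Bool) (p : H) (t : ℝ) :
    HasDerivAt (fun s => f (flow W s p)) (f' W (flow W t p)) t := by
  have h1 := h W (flow W t p)
  rw [← sub_self t] at h1
  have h2 := h1.comp_sub_const t t
  refine h2.congr_of_eventuallyEq (.of_forall fun s => ?_)
  simp [← flow_add]

lemma HasHorizDeriv.norm_flow_sub_le {f : H → E} {f' : Bool → H → E} (h : HasHorizDeriv f f')
    {W : Bool} {p : H} {t C : ℝ} (hC : ∀ s, |s| ≤ |t| → ‖f' W (flow W s p)‖ ≤ C) :
    ‖f (flow W t p) - f p‖ ≤ C * |t| := by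
  have := (convex_Icc (-|t|) |t|).norm_image_sub_le_of_norm_hasDerivWithin_le
    (f := fun s => f (flow W s p)) (f' := fun s => f' W (flow W s p)) (C := C) (x := 0) (y := t)
    (fun s _ => (h.hasDerivAt W p s).hasDerivWithinAt)
    (fun s hs => hC s (abs_le.2 hs)) (abs_le.1 (by simp)) (abs_le.1 le_rfl)
  simpa [flow_zero] using this

lemma HasHorizDeriv.flowLipschitz {f : H → E} {f' : Bool → H → E} (h : HasHorizDeriv f f')
    {C : ℝ} (hC : ∀ W p, ‖f' W p‖ ≤ C) : FlowLipschitz C f :=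
  fun _ _ _ => h.norm_flow_sub_le fun _ _ => hC _ _

/-- A quadratic Taylor bound at a horizontally critical point. -/
lemma HasHorizDeriv.norm_applyFlows_sub_le_sq {f : H → E} {f' : Bool → H → E}
    (h : HasHorizDeriv f f') {C : ℝ} (hC : 0 ≤ C) {g : H}
    (hf : ∀ W l, ‖f' W (applyFlows l g)‖ ≤ C * pathLength l) (l : List (Bool × ℝ)) :
    ‖f (applyFlows l g) - f g‖ ≤ C * pathLength l ^ 2 := by
  induction l with
  | nil => simp [applyFlows]
  | cons wt l ih =>
    obtain ⟨W, t⟩ := wt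
    have h0 := pathLength_nonneg l
    have ht := abs_nonneg t
    have h1 : ‖f (flow W t (applyFlows l g)) - f (applyFlows l g)‖ ≤
        C * (|t| + pathLength l) * |t| := by
      refine h.norm_flow_sub_le fun s hs => (hf W ((W, s) :: l)).trans ?_
      rw [pathLength_cons]
      gcongr
    rw [pathLength_cons, applyFlows]
    refine (norm_sub_le_norm_sub_add_norm_sub _ (f (applyFlows l g)) _).trans
      ((add_le_add h1 ih).trans ?_)
    nlinarith [mul_nonneg hC (mul_nonneg h0 ht)]

lemma HasHorizDeriv.add {f g : H → E} {f' g' : Bool → H → E} (hf : HasHorizDeriv f f')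
    (hg : HasHorizDeriv g g') :
    HasHorizDeriv (fun p => f p + g p) (fun W p => f' W p + g' W p) :=
  fun W p => (hf W p).add (hg W p)

lemma HasHorizDeriv.rescale {f : H → E} {f' : Bool → H → E} (hf : HasHorizDeriv f f')
    (a b : ℝ) :
    HasHorizDeriv (fun p => a • f (dilate b p)) (fun W p => (a * b) • f' W (dilate b p)) := by
  intro W p
  have h1 := hf.hasDerivAt W (dilate b p) (b * 0)
  have h2 := (h1.scomp (0 : ℝ) ((hasDerivAt_id (0 : ℝ)).const_mul b)).const_smul a
  simp only [mul_zero, flow_zero, mul_one, smul_smul] at h2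
  refine h2.congr_of_eventuallyEq (.of_forall fun s => ?_)
  simp [dilate_flow]

lemma FlowLipschitz.rescale {f : H → E} {C : ℝ} (hf : FlowLipschitz C f) {a b : ℝ}
    (ha : 0 ≤ a) (hb : 0 ≤ b) : FlowLipschitz (a * b * C) (fun p => a • f (dilate b p)) := by
  intro W t p
  rw [← smul_sub, norm_smul, Real.norm_of_nonneg ha, dilate_flow]
  have := hf W (b * t) (dilate b p)
  rw [abs_mul, abs_of_nonneg hb] at this
  calc _ ≤ a * (C * (b * |t|)) := by gcongr
    _ = _ := by ring

lemma hasHorizDeriv_of_differentiable {f : H → E} (hf : Differentiable ℝ f) :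
    HasHorizDeriv f (fun W => WD W f) := by
  intro W p
  have h2 := (hf (flow W 0 p)).hasFDerivAt
  rw [flow_zero] at h2
  cases W
  · have h1 : HasDerivAt (fun t : ℝ => flow false t p) (0, 1, 0) 0 := by
      refine (hasDerivAt_const _ _).prodMk (HasDerivAt.prodMk ?_ (hasDerivAt_const _ _))
      exact (hasDerivAt_id _).const_add _
    exact HasFDerivAt.comp_hasDerivAt_of_eq (x := (0 : ℝ)) h2 h1 (flow_zero _ _).symm
  · have h1 : HasDerivAt (fun t : ℝ => flow true t p) (1, 0, p.2.1) 0 := by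
      refine HasDerivAt.prodMk ?_ ((hasDerivAt_const _ _).prodMk ?_)
      · exact (hasDerivAt_id _).const_add _
      · simpa using ((hasDerivAt_id (0 : ℝ)).mul_const p.2.1).const_add p.2.2
    exact HasFDerivAt.comp_hasDerivAt_of_eq (x := (0 : ℝ)) h2 h1 (flow_zero _ _).symm

end HorizontalDerivative

section Bump

open scoped ContDiff

lemma contDiff_WD {f : H → ℝ} (hf : ContDiff ℝ ∞ f) (W : Bool) : ContDiff ℝ ∞ (WD W f) := by
  have := hf.fderiv_right (m := ∞) le_rfl
  cases W
  · exact this.clm_apply contDiff_const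
  · exact this.clm_apply (by fun_prop)

lemma WD_eq_zero {f : H → ℝ} {p : H} (hp : p ∉ tsupport f) (W : Bool) : WD W f p = 0 := by
  have := fderiv_of_notMem_tsupport (𝕜 := ℝ) hp
  cases W <;> simp [WD, XD, YD, this]

lemma tsupport_WD_subset (f : H → ℝ) (W : Bool) : tsupport (WD W f) ⊆ tsupport f :=
  closure_minimal (fun _ hp => by_contra fun h => hp (WD_eq_zero h W)) (isClosed_tsupport f)

lemma exists_bound_WD {f : H → ℝ} (hf : ContDiff ℝ ∞ f) (hs : HasCompactSupport f) :
    ∃ C, ∀ W p, ‖WD W f p‖ ≤ C := by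
  have h W := (contDiff_WD hf W).continuous.bounded_above_of_compact_support
    (hs.of_isClosed_subset (isClosed_tsupport _) (tsupport_WD_subset f W))
  choose C hC using h
  refine ⟨max (C true) (C false), fun W p => ?_⟩
  cases W
  · exact (hC _ p).trans (le_max_right _ _)
  · exact (hC _ p).trans (le_max_left _ _)

/-- A smooth bump function on `H`, with bounds for its first two horizontal derivatives. -/
lemma exists_bump : ∃ (b : H → ℝ) (b' : Bool → H → ℝ) (C : ℝ), 1 ≤ C ∧
    HasHorizDeriv b b' ∧ (∀ p, 0 ≤ b p ∧ b p ≤ 1) ∧ (∀ p ∈ box 1, b p = 1) ∧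
    (∀ p ∉ box 2, b p = 0) ∧ (∀ W, ∀ p ∉ box 2, b' W p = 0) ∧
    (∀ W p, |b' W p| ≤ C) ∧ ∀ W, FlowLipschitz C (b' W) := by
  have hbox : ∀ r, (0 : ℝ) ≤ r → box r = Metric.closedBall (0 : H) r := by
    intro r hr
    ext p
    simp [box, Prod.norm_def]
  let b : ContDiffBump (0 : H) := ⟨1, 2, one_pos, one_lt_two⟩
  have hb : ContDiff ℝ ∞ b := b.contDiff
  have hs : HasCompactSupport b := b.hasCompactSupport
  have htb : tsupport b = box 2 := by
    rw [b.tsupport_eq, hbox 2 zero_le_two]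
  have hs' W : HasCompactSupport (WD W b) :=
    hs.of_isClosed_subset (isClosed_tsupport _) (tsupport_WD_subset _ W)
  obtain ⟨C₀, hC₀⟩ := exists_bound_WD hb hs
  choose C₁ hC₁ using fun W => exists_bound_WD (contDiff_WD hb W) (hs' W)
  set C := max 1 (max C₀ (max (C₁ true) (C₁ false))) with hC
  refine ⟨b, fun W => WD W b, C, le_max_left _ _,
    hasHorizDeriv_of_differentiable (hb.differentiable (by simp)),
    fun p => ⟨b.nonneg, b.le_one⟩, fun p hp => b.one_of_mem_closedBall ?_,
    fun p hp => image_eq_zero_of_notMem_tsupport (htb ▸ hp),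
    fun W p hp => WD_eq_zero (htb ▸ hp) W, fun W p => (hC₀ W p).trans (by simp [hC]), fun W => ?_⟩
  · rwa [← hbox 1 zero_le_one]
  · refine (hasHorizDeriv_of_differentiable
      ((contDiff_WD hb W).differentiable (by simp))).flowLipschitz
      fun W' p => (hC₁ W W' p).trans ?_
    cases W <;> simp [hC]

end Bump

section Lattice

/-- No point of `H` lies in the right translates of `box R` by two different points of `G`. -/
def Separated (R : ℝ) (G : Set H) : Prop :=
  ∀ p, ∀ g ∈ G, ∀ g' ∈ G, rel p g ∈ box R → rel p g' ∈ box R → g = g'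

lemma intCast_eq_of_abs_sub_le {m : ℕ} {R x : ℝ} (hm : 2 * R < m) {a b : ℤ}
    (hab : (a : ZMod m) = b) (ha : |x - a| ≤ R) (hb : |x - b| ≤ R) : a = b := by
  have h1 : (m : ℤ) ∣ a - b := (ZMod.intCast_eq_intCast_iff_dvd_sub b a m).1 hab.symm
  have h2 : |a - b| < (m : ℤ) := by
    have : |(a : ℝ) - b| < m := by
      rw [abs_le] at ha hb
      rw [abs_lt]
      constructor <;> linarith
    exact_mod_cast this
  exact sub_eq_zero.1 (Int.eq_zero_of_abs_lt_dvd h1 h2)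

/-- The integer points of `H` in a given residue class. -/
def latticeClass {m : ℕ} (k : ZMod m × ZMod m × ZMod m) : Set H :=
  {g | ∃ a b c : ℤ, g = ((a : ℝ), (b : ℝ), (c : ℝ)) ∧ k = ((a : ZMod m), (b : ZMod m), (c : ZMod m))}

lemma separated_latticeClass {m : ℕ} {R : ℝ} (hm : 2 * R < m)
    (k : ZMod m × ZMod m × ZMod m) : Separated R (latticeClass k) := by
  rintro p _ ⟨a, b, c, rfl, rfl⟩ _ ⟨a', b', c', rfl, h⟩ ⟨h1, h2, h3⟩ ⟨h1', h2', h3'⟩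
  simp only [Prod.mk.injEq] at h
  obtain rfl := intCast_eq_of_abs_sub_le hm h.1 h1 h1'
  obtain rfl := intCast_eq_of_abs_sub_le hm h.2.1 h2 h2'
  have e : ∀ z u v w : ℝ, z - u + v - w = (z + v - w) - u := fun _ _ _ _ => by ring
  simp only [rel, e] at h3 h3'
  obtain rfl := intCast_eq_of_abs_sub_le hm h.2.2 h3 h3'
  rfl

lemma exists_latticeClass (m : ℕ) (p : H) :
    ∃ k : ZMod m × ZMod m × ZMod m, ∃ g ∈ latticeClass k, rel p g ∈ box 1 := by
  have key (x : ℝ) : |x - ⌊x⌋| ≤ 1 := by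
    rw [Int.self_sub_floor, abs_of_nonneg (Int.fract_nonneg x)]
    exact (Int.fract_lt_one x).le
  refine ⟨_, _, ⟨⌊p.1⌋, ⌊p.2.1⌋, ⌊p.2.2 + ⌊p.1⌋ * ⌊p.2.1⌋ - p.1 * ⌊p.2.1⌋⌋, rfl, rfl⟩,
    key _, key _, ?_⟩
  convert key (p.2.2 + ⌊p.1⌋ * ⌊p.2.1⌋ - p.1 * ⌊p.2.1⌋) using 2
  simp only [rel]
  ring

end Lattice

section BumpField

variable {E : Type*} [NormedAddCommGroup E] [NormedSpace ℝ E]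

open Classical in
/-- The sum over `g ∈ G` of the right translates of `b` by `g`, with values in `ℝ • v g`. -/
def bumpField (G : Set H) (v : H → E) (b : H → ℝ) (p : H) : E :=
  if h : ∃ g ∈ G, rel p g ∈ box 2 then b (rel p h.choose) • v h.choose else 0

lemma bumpField_eq {R : ℝ} (hR : 2 ≤ R) {G : Set H} (hG : Separated R G) {v : H → E}
    {b : H → ℝ} (hb : ∀ p ∉ box 2, b p = 0) {p g : H} (hg : g ∈ G) (hp : rel p g ∈ box R) :
    bumpField G v b p = b (rel p g) • v g := by
  unfold bumpField
  split_ifs with h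
  · rw [hG p _ h.choose_spec.1 g hg (box_mono hR h.choose_spec.2) hp]
  · rw [hb _ fun h2 => h ⟨g, hg, h2⟩, zero_smul]

lemma bumpField_eq_zero {G : Set H} {v : H → E} {b : H → ℝ} {p : H}
    (h : ∀ g ∈ G, rel p g ∉ box 2) : bumpField G v b p = 0 :=
  dif_neg fun ⟨g, hg, h2⟩ => h g hg h2

lemma flow_mem_box {W : Bool} {t : ℝ} (ht : |t| ≤ 1) {p : H} (hp : p ∈ box 2) :
    flow W t p ∈ box 4 := by
  obtain ⟨h1, h2, h3⟩ := hp
  cases W <;> simp only [flow, flowX, flowY]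
  · exact ⟨by linarith, (abs_add_le _ _).trans (by linarith), by linarith⟩
  · refine ⟨(abs_add_le _ _).trans (by linarith), by linarith, (abs_add_le _ _).trans ?_⟩
    rw [abs_mul]
    nlinarith [abs_nonneg t, abs_nonneg p.2.1]

/-- Near every point, a bump field is a single translated bump. -/
lemma exists_bumpField_flow_eq {R : ℝ} (hR : 4 ≤ R) {G : Set H} (hG : Separated R G) {v : H → E}
    (hv : ∀ g, ‖v g‖ = 1) (p : H) :
    ∃ (q : H) (w : E), ‖w‖ ≤ 1 ∧ ∀ b : H → ℝ, (∀ p ∉ box 2, b p = 0) → ∀ W t, |t| ≤ 1 →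
      bumpField G v b (flow W t p) = b (flow W t q) • w := by
  by_cases h : ∃ g ∈ G, rel p g ∈ box 4
  · obtain ⟨g, hg, hp⟩ := h
    refine ⟨rel p g, v g, (hv g).le, fun b hb W t ht => ?_⟩
    by_cases h' : ∃ g' ∈ G, rel (flow W t p) g' ∈ box 2
    · obtain ⟨g', hg', hp'⟩ := h'
      have h4 := flow_mem_box (W := W) (t := -t) (by rwa [abs_neg]) hp'
      rw [rel_flow, flow_neg_flow] at h4
      obtain rfl := hG p g hg g' hg' (box_mono hR hp) (box_mono hR h4)
      rw [bumpField_eq (by linarith) hG hb hg (box_mono (by linarith) hp'), rel_flow]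
    · rw [bumpField_eq_zero fun g' hg' hp' => h' ⟨g', hg', hp'⟩, hb, zero_smul]
      rw [← rel_flow]
      exact fun hp' => h' ⟨g, hg, hp'⟩
  · refine ⟨0, 0, by simp, fun b hb W t ht => ?_⟩
    rw [smul_zero]
    refine bumpField_eq_zero fun g hg hp => h ⟨g, hg, ?_⟩
    have h4 := flow_mem_box (W := W) (t := -t) (by rwa [abs_neg]) hp
    rwa [rel_flow, flow_neg_flow] at h4

lemma hasHorizDeriv_bumpField {R : ℝ} (hR : 4 ≤ R) {G : Set H} (hG : Separated R G) {v : H → E}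
    (hv : ∀ g, ‖v g‖ = 1) {b : H → ℝ} {b' : Bool → H → ℝ} (hbb : HasHorizDeriv b b')
    (hb : ∀ p ∉ box 2, b p = 0) (hb' : ∀ W, ∀ p ∉ box 2, b' W p = 0) :
    HasHorizDeriv (bumpField G v b) (fun W => bumpField G v (b' W)) := by
  intro W p
  obtain ⟨q, w, -, h⟩ := exists_bumpField_flow_eq hR hG hv p
  have h0 := h (b' W) (hb' W) W 0 (by simp)
  simp only [flow_zero] at h0
  change HasDerivAt _ (bumpField G v (b' W) p) 0
  rw [h0]
  refine ((hbb W q).smul_const w).congr_of_eventuallyEq ?_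
  filter_upwards [Metric.ball_mem_nhds (0 : ℝ) one_pos] with t ht
  exact h b hb W t (by simpa using (Metric.mem_ball.1 ht).le)

lemma norm_bumpField_le {R : ℝ} (hR : 4 ≤ R) {G : Set H} (hG : Separated R G) {v : H → E}
    (hv : ∀ g, ‖v g‖ = 1) {b : H → ℝ} (hb : ∀ p ∉ box 2, b p = 0) {C : ℝ}
    (hC : ∀ p, |b p| ≤ C) (p : H) : ‖bumpField G v b p‖ ≤ C := by
  obtain ⟨q, w, hw, h⟩ := exists_bumpField_flow_eq hR hG hv p
  have h0 := h b hb true 0 (by simp)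
  simp only [flow_zero] at h0
  rw [h0, norm_smul]
  exact (mul_le_of_le_one_right (norm_nonneg _) hw).trans (hC q)

lemma flowLipschitz_bumpField {R : ℝ} (hR : 4 ≤ R) {G : Set H} (hG : Separated R G) {v : H → E}
    (hv : ∀ g, ‖v g‖ = 1) {b : H → ℝ} (hb : ∀ p ∉ box 2, b p = 0) {C : ℝ} (hC0 : 0 ≤ C)
    (hC : ∀ p, |b p| ≤ C) (hL : FlowLipschitz C b) :
    FlowLipschitz (2 * C) (bumpField G v b) := by
  intro W t p
  rcases le_total |t| 1 with ht | ht
  · obtain ⟨q, w, hw, h⟩ := exists_bumpField_flow_eq hR hG hv p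
    have h0 := h b hb W 0 (by simp)
    simp only [flow_zero] at h0
    rw [h0, h b hb W t ht, ← sub_smul, norm_smul]
    refine (mul_le_of_le_one_right (norm_nonneg _) hw).trans ((hL W t q).trans ?_)
    nlinarith [mul_nonneg hC0 (abs_nonneg t)]
  · refine (norm_sub_le _ _).trans ?_
    have h1 := norm_bumpField_le hR hG hv hb hC
    nlinarith [h1 p, h1 (flow W t p)]

end BumpField

section Construction

/-- The pairs of points that a unit-scale bump field over `G` has to tell apart. -/
def IsTestPair (G : Set H) (p p' : H) : Prop :=
  (∃ g ∈ G, rel p g ∈ box 1) ∧ 99 ≤ ccDist p p' ∧ ccDist p p' ≤ 198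

lemma rel_rel (p p' g : H) : rel (rel p' g) (rel p g) = rel p' p := by
  ext <;> simp [rel]
  ring

lemma ccDist_lt_of_rel_mem_box {p p' g : H} (hp : rel p g ∈ box 1) (hp' : rel p' g ∈ box 2) :
    ccDist p p' < 99 := by
  have h : rel p' p ∈ box 6 := by
    rw [← rel_rel p p' g]
    obtain ⟨h1, h2, h3⟩ := hp
    obtain ⟨h1', h2', h3'⟩ := hp'
    generalize rel p g = u at *
    generalize rel p' g = u' at *
    have e1 : |u.1 * u.2.1| ≤ 1 := by rw [abs_mul]; nlinarith [abs_nonneg u.1, abs_nonneg u.2.1]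
    have e2 : |u'.1 * u.2.1| ≤ 2 := by
      rw [abs_mul]; nlinarith [abs_nonneg u'.1, abs_nonneg u.2.1]
    rw [abs_le] at h1 h2 h3 h1' h2' h3' e1 e2
    simp only [box, rel, Set.mem_ofPred_eq, abs_le]
    refine ⟨⟨?_, ?_⟩, ⟨?_, ?_⟩, ?_, ?_⟩ <;> linarith
  obtain ⟨l, hl, hl'⟩ := exists_path_of_rel_mem_box h
  exact (ccDist_le hl).trans_lt (by linarith)

local notation "V" => EuclideanSpace ℝ (Fin 3)

lemma exists_unit_orthogonal (a b : V) : ∃ v : V, ‖v‖ = 1 ∧ ⟪v, a⟫ = 0 ∧ ⟪v, b⟫ = 0 := by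
  have h1 : Module.finrank ℝ (Submodule.span ℝ (Set.range ![a, b])) ≤ 2 :=
    finrank_range_le_card (R := ℝ) ![a, b]
  have h2 := (Submodule.span ℝ (Set.range ![a, b])).finrank_add_finrank_orthogonal
  rw [finrank_euclideanSpace_fin] at h2
  have h3 : (Submodule.span ℝ (Set.range ![a, b]))ᗮ ≠ ⊥ := by
    intro h
    rw [h, finrank_bot] at h2
    omega
  obtain ⟨w, hw, hw0⟩ := Submodule.exists_mem_ne_zero_of_ne_bot h3
  rw [Submodule.mem_orthogonal'] at hw
  refine ⟨‖w‖⁻¹ • w, norm_smul_inv_norm hw0, ?_, ?_⟩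
  · rw [real_inner_smul_left, hw a (Submodule.subset_span ⟨0, rfl⟩), mul_zero]
  · rw [real_inner_smul_left, hw b (Submodule.subset_span ⟨1, rfl⟩), mul_zero]

lemma HasHorizDeriv.inner {f : H → V} {f' : Bool → H → V} (h : HasHorizDeriv f f') (v : V) :
    HasHorizDeriv (fun p => ⟪v, f p⟫) (fun W p => ⟪v, f' W p⟫) := fun W p => by
  simpa using (hasDerivAt_const (0 : ℝ) v).inner ℝ (h W p)

/-- A slowly varying map `F` can be perturbed at unit scale so as to separate all test pairs,
while the squared norm of its horizontal gradient increases by a bounded amount only. -/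
lemma exists_unit_scale_perturbation {G : Set H} (hG : Separated 50000 G)
    {b : H → ℝ} {b' : Bool → H → ℝ} {C : ℝ} (hC1 : 1 ≤ C)
    (hbb : HasHorizDeriv b b') (hb01 : ∀ p, 0 ≤ b p ∧ b p ≤ 1) (hb1 : ∀ p ∈ box 1, b p = 1)
    (hb0 : ∀ p ∉ box 2, b p = 0) (hb'0 : ∀ W, ∀ p ∉ box 2, b' W p = 0)
    (hC : ∀ W p, |b' W p| ≤ C) (hL : ∀ W, FlowLipschitz C (b' W))
    {F : H → V} {F' : Bool → H → V} {S η : ℝ} (hF : HasHorizDeriv F F')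
    (hS : ∀ W p, ‖F' W p‖ ^ 2 ≤ S) (hη : 0 ≤ η) (hη1 : 200000 * η ≤ 1)
    (hFL : ∀ W, FlowLipschitz η (F' W)) :
    ∃ (f : H → V) (f' : Bool → H → V), HasHorizDeriv f f' ∧
      (∀ W p, ‖f' W p‖ ^ 2 ≤ S + 2 * C + C ^ 2) ∧ (∀ W, FlowLipschitz (η + 2 * C) (f' W)) ∧
      (∀ p, ‖f p - F p‖ ≤ 1) ∧ ∀ p p', IsTestPair G p p' → 1 / 2 ≤ ‖f p - f p'‖ := by
  choose v hv hvt hvf using fun g => exists_unit_orthogonal (F' true g) (F' false g)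
  have hvF : ∀ W g, ⟪v g, F' W g⟫ = 0 := fun W g => by cases W <;> simp [hvt, hvf]
  have hinner : ∀ W l g, ‖⟪v g, F' W (applyFlows l g)⟫‖ ≤ η * pathLength l := fun W l g => by
    have h1 := (hFL W).norm_applyFlows_sub_le l g
    have h2 := norm_inner_le_norm (𝕜 := ℝ) (v g) (F' W (applyFlows l g) - F' W g)
    rw [inner_sub_right, hvF, sub_zero, hv, one_mul] at h2
    exact h2.trans h1
  refine ⟨fun p => F p + bumpField G v b p, fun W p => F' W p + bumpField G v (b' W) p,
    hF.add (hasHorizDeriv_bumpField (by norm_num) hG hv hbb hb0 hb'0), fun W p => ?_,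
    fun W => (hFL W).add (flowLipschitz_bumpField (by norm_num) hG hv (hb'0 W) (by linarith)
      (hC W) (hL W)), fun p => ?_, fun p p' hpp' => ?_⟩
  · have h1 := norm_bumpField_le (v := v) (by norm_num) hG hv (hb'0 W) (hC W) p
    have h2 : ⟪F' W p, bumpField G v (b' W) p⟫ ≤ C := by
      by_cases h : ∃ g ∈ G, rel p g ∈ box 2
      · obtain ⟨g, hg, hpg⟩ := h
        rw [bumpField_eq (by norm_num) hG (hb'0 W) hg (box_mono (by norm_num) hpg),
          inner_smul_right, real_inner_comm]
        obtain ⟨l, hl, hl'⟩ := exists_path_of_rel_mem_box hpg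
        have h3 := hinner W l g
        rw [hl, Real.norm_eq_abs] at h3
        have h4 : |⟪v g, F' W p⟫| ≤ 1 := h3.trans (by nlinarith)
        refine (le_abs_self _).trans ?_
        rw [abs_mul]
        exact (mul_le_of_le_one_right (abs_nonneg _) h4).trans (hC W _)
      · rw [bumpField_eq_zero fun g hg hp => h ⟨g, hg, hp⟩, inner_zero_right]
        linarith
    rw [norm_add_sq_real]
    have := hS W p
    have : ‖bumpField G v (b' W) p‖ ^ 2 ≤ C ^ 2 := by gcongr
    linarith
  · rw [add_sub_cancel_left]
    exact norm_bumpField_le (by norm_num) hG hv hb0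
      (fun p => abs_le.2 ⟨by linarith [hb01 p], (hb01 p).2⟩) p
  · obtain ⟨⟨g, hg, hpg⟩, hd, hd'⟩ := hpp'
    obtain ⟨l, hl, hll⟩ := exists_path_of_rel_mem_box hpg
    obtain ⟨l', hl', hll'⟩ := exists_path_lt (hd'.trans_lt (by norm_num : (198 : ℝ) < 199))
    have hl0 := pathLength_nonneg l
    have hl0' := pathLength_nonneg l'
    have hl2 : applyFlows (l' ++ l) g = p' := by rw [applyFlows_append, hl, hl']
    have hll2 : pathLength (l' ++ l) ≤ 207 := by rw [pathLength_append]; linarith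
    have h1 := (hF.inner (v g)).norm_applyFlows_sub_le_sq hη (fun W l => hinner W l g) l
    have h2 := (hF.inner (v g)).norm_applyFlows_sub_le_sq hη (fun W l => hinner W l g) (l' ++ l)
    rw [hl, Real.norm_eq_abs] at h1
    rw [hl2, Real.norm_eq_abs] at h2
    have e1 : η * pathLength l ^ 2 ≤ η * 207 ^ 2 := by gcongr; linarith
    have e2 : η * pathLength (l' ++ l) ^ 2 ≤ η * 207 ^ 2 := by
      gcongr; exact pathLength_nonneg _
    have hp : bumpField G v b p = v g := by
      rw [bumpField_eq (by norm_num) hG hb0 hg (box_mono (by norm_num) hpg), hb1 _ hpg, one_smul]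
    have hp' : bumpField G v b p' = 0 := by
      rw [bumpField_eq (R := 50000) (by norm_num) hG hb0 hg (box_mono (by norm_num)
        (rel_mem_box_of_path hl2 (by norm_num) hll2)), hb0, zero_smul]
      exact fun h => absurd (ccDist_lt_of_rel_mem_box hpg h) hd.not_gt
    have h3 := norm_inner_le_norm (𝕜 := ℝ) (v g) ((F p + v g) - F p')
    rw [hv, one_mul, inner_sub_right, inner_add_right, real_inner_self_eq_norm_sq, hv] at h3
    simp only [hp, hp', add_zero]
    refine le_trans ?_ h3
    refine le_trans ?_ (le_abs_self _)
    rw [abs_le] at h1 h2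
    linarith

/-- A finite stage of the multiscale construction; the scales `1, A, …, A ^ (k - 1)` have been
treated. -/
structure IsStage (A μ S B : ℝ) (G : Set H) (k : ℕ) (f : H → V) (f' : Bool → H → V) : Prop where
  deriv : HasHorizDeriv f f'
  grad : ∀ W p, ‖f' W p‖ ^ 2 ≤ S
  lip : ∀ W, FlowLipschitz B (f' W)
  upper : ∀ n < k, ∀ p p', ‖f p - f p'‖ ≤ √S * μ ^ n * ccDist p p' + (2 * (A * μ) ^ n - 2)
  lower : ∀ n < k, ∀ p p', IsTestPair G (dilate (A ^ n)⁻¹ p) (dilate (A ^ n)⁻¹ p') →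
    (A * μ) ^ n / 4 + 1 / 4 ≤ ‖f p - f p'‖

lemma exists_isStage {b : H → ℝ} {b' : Bool → H → ℝ} {C : ℝ} (hC1 : 1 ≤ C)
    (hbb : HasHorizDeriv b b') (hb01 : ∀ p, 0 ≤ b p ∧ b p ≤ 1) (hb1 : ∀ p ∈ box 1, b p = 1)
    (hb0 : ∀ p ∉ box 2, b p = 0) (hb'0 : ∀ W, ∀ p ∉ box 2, b' W p = 0)
    (hC : ∀ W p, |b' W p| ≤ C) (hL : ∀ W, FlowLipschitz C (b' W))
    {G : Set H} (hG : Separated 50000 G) {A μ S : ℝ} (hA : 800000 * C ≤ A) (hμ0 : 0 < μ)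
    (hμ1 : μ ≤ 1) (hAμ : 9 ≤ A * μ) (hS : μ ^ 2 * S + 2 * C + C ^ 2 ≤ S) (k : ℕ) :
    ∃ f f', IsStage A μ S (4 * C) G k f f' := by
  have hS0 : 0 ≤ S := by
    have : 0 ≤ 1 - μ ^ 2 := by nlinarith
    by_contra! h
    nlinarith [mul_nonneg this (neg_nonneg.2 h.le)]
  have hA0 : 0 < A := by linarith
  induction k with
  | zero =>
    refine ⟨fun _ => 0, fun _ _ => 0, fun W p => hasDerivAt_const _ _, fun W p => by simpa,
      fun W W' t p => ?_, fun n hn => absurd hn (Nat.not_lt_zero n),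
      fun n hn => absurd hn (Nat.not_lt_zero n)⟩
    rw [sub_self, norm_zero]
    positivity
  | succ k ih =>
    obtain ⟨f, f', hf⟩ := ih
    have eA : A * μ * A⁻¹ = μ := by field_simp
    obtain ⟨φ, φ', h1, h2, h3, h4, h5⟩ := exists_unit_scale_perturbation (S := μ ^ 2 * S)
      (η := 4 * C / A) hG hC1 hbb hb01 hb1 hb0 hb'0 hC hL (hf.deriv.rescale (A * μ) A⁻¹)
      (fun W p => by
        rw [eA, norm_smul, mul_pow, Real.norm_of_nonneg hμ0.le]
        exact mul_le_mul_of_nonneg_left (hf.grad _ _) (by positivity))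
      (by positivity)
      (by rw [mul_div_assoc', div_le_one hA0]; linarith)
      (fun W W' t p => (((hf.lip W).rescale (a := A * μ * A⁻¹) (b := A⁻¹) (by positivity)
        (by positivity)) W' t p).trans (by
          rw [eA, div_eq_inv_mul]
          gcongr
          exact mul_le_of_le_one_left (by positivity) hμ1))
    have hdiff : ∀ p p', ‖(φ p - φ p') -
        (A * μ) • (f (dilate A⁻¹ p) - f (dilate A⁻¹ p'))‖ ≤ 2 := fun p p' => by
      have := (norm_sub_le (φ p - (A * μ) • f (dilate A⁻¹ p))
        (φ p' - (A * μ) • f (dilate A⁻¹ p'))).trans (add_le_add (h4 p) (h4 p'))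
      rw [smul_sub, sub_sub_sub_comm]
      linarith
    have hgrad W p : ‖φ' W p‖ ^ 2 ≤ S := (h2 W p).trans hS
    refine ⟨φ, φ', h1, hgrad, fun W W' t p => ?_, ?_, ?_⟩
    · refine (h3 W W' t p).trans ?_
      gcongr
      have : 4 * C / A ≤ 1 := by rw [div_le_one hA0]; linarith
      linarith
    · rintro (_ | n) hn p p'
      · have := (h1.flowLipschitz (C := √S) fun W p => Real.le_sqrt_of_sq_le (hgrad W p)).norm_sub_le
          (Real.sqrt_nonneg _) p p'
        simpa using this
      · have e1 := hf.upper n (by omega) (dilate A⁻¹ p) (dilate A⁻¹ p')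
        rw [ccDist_dilate (inv_pos.2 hA0)] at e1
        have e2 := (norm_le_norm_add_norm_sub' _ _).trans (add_le_add le_rfl (hdiff p p'))
        rw [norm_smul, Real.norm_of_nonneg (by positivity)] at e2
        refine e2.trans ?_
        have e3 := mul_le_mul_of_nonneg_left e1 (by positivity : 0 ≤ A * μ)
        have e4 : A * μ * (√S * μ ^ n * (A⁻¹ * ccDist p p') + (2 * (A * μ) ^ n - 2)) =
            √S * μ ^ (n + 1) * ccDist p p' + (2 * (A * μ) ^ (n + 1) - 2 * (A * μ)) := by
          field_simp
          ring
        linarith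
    · rintro (_ | n) hn p p' hpp'
      · have := h5 p p' (by simpa [dilate_one] using hpp')
        simp only [pow_zero]
        linarith
      · have e1 := hf.lower n (by omega) (dilate A⁻¹ p) (dilate A⁻¹ p') (by
          rwa [dilate_dilate, dilate_dilate, ← mul_inv, ← pow_succ])
        have e2 := (norm_le_norm_add_norm_sub _ _).trans (add_le_add le_rfl (hdiff p p'))
        rw [norm_smul, Real.norm_of_nonneg (by positivity)] at e2
        have e3 := mul_le_mul_of_nonneg_left e1 (by positivity : 0 ≤ A * μ)
        rw [pow_succ]
        linarith

end Construction

section Limit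

open Filter Topology

local notation "V" => EuclideanSpace ℝ (Fin 3)

lemma exists_tendsto_hyperfilter {α : Type*} {F : ℕ → α → V} {C : α → ℝ}
    (h : ∀ L p, ‖F L p‖ ≤ C p) :
    ∃ Φ : α → V, ∀ p, Tendsto (fun L => F L p) (hyperfilter ℕ) (𝓝 (Φ p)) := by
  have key p : ∃ x, Tendsto (fun L => F L p) (hyperfilter ℕ) (𝓝 x) := by
    obtain ⟨x, -, hx⟩ := (isCompact_closedBall (0 : V) (C p)).ultrafilter_le_nhds
      ((hyperfilter ℕ).map fun L => F L p) (by
        rw [le_principal_iff]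
        exact Ultrafilter.mem_map.2 (Filter.univ_mem' fun L => by simpa using h L p))
    exact ⟨x, hx⟩
  choose Φ hΦ using key
  exact ⟨Φ, hΦ⟩

/-- The limit of the multiscale construction as the number of scales tends to infinity. -/
lemma exists_limit_of_isStage {A μ S B : ℝ} {G : Set H} (hA : 0 < A) (hμ : 0 < μ)
    (h : ∀ k, ∃ f f', IsStage A μ S B G k f f') :
    ∃ Φ : H → V, (∀ (j : ℤ) p p', ‖Φ p - Φ p'‖ ≤ √S * μ ^ j * ccDist p p' + 2 * (A * μ) ^ j) ∧
      ∀ (j : ℤ) p p', IsTestPair G (dilate (A ^ j)⁻¹ p) (dilate (A ^ j)⁻¹ p') →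
        (A * μ) ^ j / 4 ≤ ‖Φ p - Φ p'‖ := by
  choose f f' hf using h
  let F : ℕ → H → V := fun L p =>
    ((A * μ) ^ L)⁻¹ • (f (2 * L + 1) (dilate (A ^ L) p) - f (2 * L + 1) (dilate (A ^ L) 0))
  have hAμ : 0 < A * μ := by positivity
  have hFF L p p' : ‖F L p - F L p'‖ = ((A * μ) ^ L)⁻¹ *
      ‖f (2 * L + 1) (dilate (A ^ L) p) - f (2 * L + 1) (dilate (A ^ L) p')‖ := by
    simp only [F]
    rw [← smul_sub, sub_sub_sub_cancel_right, norm_smul, Real.norm_of_nonneg (by positivity)]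
  have hn (j : ℤ) (L : ℕ) (hL : j.natAbs ≤ L) : ∃ n < 2 * L + 1, (n : ℤ) = j + L :=
    ⟨(j + L).toNat, by omega, by omega⟩
  have hpow {x : ℝ} (hx : 0 < x) {j : ℤ} {n L : ℕ} (hnj : (n : ℤ) = j + L) :
      x ^ n = x ^ j * x ^ L := by
    rw [← zpow_natCast, hnj, zpow_add₀ hx.ne', zpow_natCast]
  have upper (j : ℤ) (p p' : H) (L : ℕ) (hL : j.natAbs ≤ L) :
      ‖F L p - F L p'‖ ≤ √S * μ ^ j * ccDist p p' + 2 * (A * μ) ^ j := by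
    obtain ⟨n, hn1, hn2⟩ := hn j L hL
    have e := (hf (2 * L + 1)).upper n hn1 (dilate (A ^ L) p) (dilate (A ^ L) p')
    rw [ccDist_dilate (by positivity), hpow hμ hn2, hpow hAμ hn2] at e
    rw [hFF, inv_mul_le_iff₀ (by positivity)]
    refine e.trans ?_
    have : √S * (μ ^ j * μ ^ L) * (A ^ L * ccDist p p') =
        (A * μ) ^ L * (√S * μ ^ j * ccDist p p') := by rw [mul_pow]; ring
    rw [this]
    linarith
  have lower (j : ℤ) (p p' : H)
      (hpp' : IsTestPair G (dilate (A ^ j)⁻¹ p) (dilate (A ^ j)⁻¹ p'))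
      (L : ℕ) (hL : j.natAbs ≤ L) : (A * μ) ^ j / 4 ≤ ‖F L p - F L p'‖ := by
    obtain ⟨n, hn1, hn2⟩ := hn j L hL
    have ed (q : H) : dilate (A ^ n)⁻¹ (dilate (A ^ L) q) = dilate (A ^ j)⁻¹ q := by
      rw [dilate_dilate, hpow hA hn2]
      congr 1
      field_simp
    have e := (hf (2 * L + 1)).lower n hn1 (dilate (A ^ L) p) (dilate (A ^ L) p')
      (by rwa [ed, ed])
    rw [hpow hAμ hn2] at e
    rw [hFF, le_inv_mul_iff₀ (by positivity)]
    linarith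
  obtain ⟨Φ, hΦ⟩ := exists_tendsto_hyperfilter (F := F)
    (C := fun p => √S * μ ^ (0 : ℤ) * ccDist p 0 + 2 * (A * μ) ^ (0 : ℤ))
    (fun L p => by
      have := upper 0 p 0 L (by simp)
      rwa [show F L 0 = 0 by simp [F], sub_zero] at this)
  have hlim p p' := ((hΦ p).sub (hΦ p')).norm
  have hev (j : ℤ) : ∀ᶠ L in (hyperfilter ℕ : Filter ℕ), j.natAbs ≤ L :=
    Nat.hyperfilter_le_atTop (eventually_ge_atTop _)
  exact ⟨Φ, fun j p p' => le_of_tendsto (hlim p p') ((hev j).mono fun L => upper j p p' L),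
    fun j p p' h => ge_of_tendsto (hlim p p') ((hev j).mono fun L => lower j p p' h L)⟩

end Limit

section Assembly

local notation "V" => EuclideanSpace ℝ (Fin 3)

lemma rpow_zpow_comm {A : ℝ} (hA : 0 ≤ A) (s : ℝ) (j : ℤ) : (A ^ s) ^ j = (A ^ j) ^ s := by
  rw [← Real.rpow_intCast, ← Real.rpow_intCast, ← Real.rpow_mul hA, ← Real.rpow_mul hA, mul_comm]

/-- The maps which separate the pairs at scales `A ^ j` whose first point is close to a translate
of `G`. -/
lemma exists_separating_map : ∃ C : ℝ, 1 ≤ C ∧ ∀ A : ℝ, 800000 * C ≤ A → ∀ G : Set H,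
    Separated 50000 G → ∀ ε : ℝ, 0 < ε → ε ≤ 1 / 2 → ∃ Φ : H → V,
      (∀ p p', ‖Φ p - Φ p'‖ ≤ (2 * C * A + 2) * ε ^ (-(1 / 2 : ℝ)) * ccDist p p' ^ (1 - ε)) ∧
      ∀ (j : ℤ) p p', IsTestPair G (dilate (A ^ j)⁻¹ p) (dilate (A ^ j)⁻¹ p') →
        (A ^ j) ^ (1 - ε) / 4 ≤ ‖Φ p - Φ p'‖ := by
  obtain ⟨b, b', C, hC1, hbb, hb01, hb1, hb0, hb'0, hC, hL⟩ := exists_bump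
  refine ⟨C, hC1, fun A hA G hG ε hε hε' => ?_⟩
  have hA1 : 1 ≤ A := by linarith
  have hA0 : 0 < A := by linarith
  set s : ℝ := ε ^ (-(1 / 2 : ℝ)) with hs
  have hs0 : 0 < s := by positivity
  have hs2 : s ^ 2 * ε = 1 := by
    rw [hs, ← Real.rpow_natCast, ← Real.rpow_mul hε.le]
    norm_num
    rw [Real.rpow_neg_one, inv_mul_cancel₀ hε.ne']
  have hs1 : 1 ≤ s := Real.one_le_rpow_of_pos_of_le_one_of_nonpos hε (by linarith) (by norm_num)
  set μ : ℝ := A ^ (-ε) with hμ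
  have hμ0 : 0 < μ := by positivity
  have hAμ : A * μ = A ^ (1 - ε) := by
    rw [hμ, sub_eq_add_neg, Real.rpow_add hA0, Real.rpow_one]
  have hμ2 : μ ^ 2 ≤ 1 - 3 / 4 * ε := by
    have h1 : μ ≤ 2 ^ (-ε) := Real.rpow_le_rpow_of_nonpos two_pos (by linarith) (by linarith)
    have h2 : ((2 : ℝ) ^ (-ε)) ^ 2 = (1 + (-3 / 4)) ^ ε := by
      rw [← Real.rpow_natCast, ← Real.rpow_mul two_pos.le, mul_comm, Real.rpow_mul two_pos.le,
        Real.rpow_neg (by positivity), ← Real.inv_rpow (by positivity)]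
      norm_num
    have h3 := rpow_one_add_le_one_add_mul_self (s := -3 / 4) (by norm_num) hε.le
      (by linarith : ε ≤ 1)
    calc μ ^ 2 ≤ ((2 : ℝ) ^ (-ε)) ^ 2 := by gcongr
      _ ≤ _ := by rw [h2]; linarith
  obtain ⟨Φ, hu, hl⟩ := exists_limit_of_isStage (A := A) (μ := μ) (S := (2 * C * s) ^ 2)
    (B := 4 * C) (G := G) hA0 hμ0 fun k => exists_isStage hC1 hbb hb01 hb1 hb0 hb'0 hC hL hG hA hμ0
      (Real.rpow_le_one_of_one_le_of_nonpos hA1 (by linarith)) (by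
        rw [hAμ]
        calc (9 : ℝ) = 81 ^ (1 / 2 : ℝ) := by
              rw [← Real.sqrt_eq_rpow, show (81 : ℝ) = 9 ^ 2 by norm_num, Real.sqrt_sq]
              norm_num
          _ ≤ A ^ (1 / 2 : ℝ) := by gcongr; linarith
          _ ≤ A ^ (1 - ε) := Real.rpow_le_rpow_of_exponent_le hA1 (by linarith)) (by
        have h1 := mul_le_mul_of_nonneg_right hμ2 (sq_nonneg (2 * C * s))
        have h2 : (1 - 3 / 4 * ε) * (2 * C * s) ^ 2 =
            (2 * C * s) ^ 2 - 3 * C ^ 2 * (s ^ 2 * ε) := by ring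
        rw [h2, hs2] at h1
        nlinarith) k
  rw [Real.sqrt_sq (by positivity)] at hu
  refine ⟨Φ, fun p p' => ?_, fun j p p' h => ?_⟩
  · rcases eq_or_ne p p' with rfl | hne
    · rw [sub_self, norm_zero, ccDist_self]
      positivity
    · have hd := ccDist_pos hne
      obtain ⟨n, hn1, hn2⟩ := exists_mem_Ico_zpow hd (by linarith : 1 < A)
      set d := ccDist p p'
      have h1 : μ ^ n * d ≤ A * d ^ (1 - ε) := by
        rw [hμ, rpow_zpow_comm hA0.le]
        have h2 : (A ^ n) ^ (-ε) ≤ (d / A) ^ (-ε) := by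
          refine Real.rpow_le_rpow_of_nonpos (by positivity) ?_ (by linarith)
          rw [zpow_add_one₀ hA0.ne'] at hn2
          exact ((div_lt_iff₀ hA0).2 hn2).le
        have h3 : (d / A) ^ (-ε) ≤ A * d ^ (-ε) := by
          rw [Real.div_rpow hd.le hA0.le, Real.rpow_neg hA0.le, div_inv_eq_mul, mul_comm]
          gcongr
          exact Real.rpow_le_self_of_one_le hA1 (by linarith)
        rw [sub_eq_neg_add, Real.rpow_add_one hd.ne', ← mul_assoc]
        exact mul_le_mul_of_nonneg_right (h2.trans h3) hd.le
      have h2 : (A * μ) ^ n ≤ s * d ^ (1 - ε) := by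
        rw [hAμ, rpow_zpow_comm hA0.le]
        refine le_trans ?_ (le_mul_of_one_le_left (by positivity) hs1)
        exact Real.rpow_le_rpow (by positivity) hn1 (by linarith)
      refine (hu n p p').trans ?_
      have h3 := mul_le_mul_of_nonneg_left h1 (by positivity : 0 ≤ 2 * C * s)
      linarith
  · have := hl j p p' h
    rwa [hAμ, rpow_zpow_comm hA0.le] at this

lemma norm_piLp_le_sum {ι : Type*} [Fintype ι] (x : PiLp 2 fun _ : ι => V) :
    ‖x‖ ≤ ∑ i, ‖x i‖ := by
  rw [PiLp.norm_eq_of_L2]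
  exact Real.sqrt_le_iff.2 ⟨by positivity, Finset.sum_sq_le_sq_sum_of_nonneg fun _ _ => norm_nonneg _⟩

end Assembly

end Heisenberg


/-- **Assouad embedding of the Heisenberg group with optimal distortion into bounded
dimension.**  There exist a dimension `D` and an absolute constant `K ≥ 1` such that for
every `0 < ε ≤ 1/2` the snowflaked space `(H, d^{1-ε})` embeds into `ℝ^D` with distortion
`K·ε^{-1/2}`. -/
theorem statement0 :
    ∃ (D : ℕ) (K : ℝ), 1 ≤ K ∧
      ∀ ε : ℝ, 0 < ε → ε ≤ 1 / 2 →
        ∃ (Φ : H → EuclideanSpace ℝ (Fin D)) (c : ℝ), 0 < c ∧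
          ∀ p p' : H,
            c * ccDist p p' ^ (1 - ε) ≤ ‖Φ p - Φ p'‖ ∧
            ‖Φ p - Φ p'‖ ≤ c * K * ε ^ (-(1 / 2 : ℝ)) * ccDist p p' ^ (1 - ε) := by
  obtain ⟨C, hC1, hmain⟩ := exists_separating_map
  obtain ⟨m, hm⟩ := exists_nat_gt (2 * 50000 : ℝ)
  obtain ⟨M, hM⟩ := pow_unbounded_of_one_lt (800000 * C) one_lt_two
  have : NeZero m := ⟨by rintro rfl; norm_num at hm⟩
  have hM0 : 0 < M := Nat.pos_of_ne_zero (by rintro rfl; norm_num at hM; linarith)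
  set A : ℝ := 2 ^ M with hA
  have hA1 : 1 ≤ A := by linarith
  let ι := Fin M × ZMod m × ZMod m × ZMod m
  let T := PiLp 2 fun _ : ι => EuclideanSpace ℝ (Fin 3)
  let e := (stdOrthonormalBasis ℝ T).repr
  set Q : ℝ := Fintype.card ι * (2 * C * A + 2)
  have hQ : 0 ≤ Q := by positivity
  refine ⟨Module.finrank ℝ T, 792 * A * Q + 1, by
    have : 0 ≤ 792 * A * Q := by positivity
    linarith, fun ε hε hε' => ?_⟩
  choose Φ hu hl using fun k : ZMod m × ZMod m × ZMod m =>
    hmain A hM.le (latticeClass k) (separated_latticeClass hm k) ε hε hε'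
  let F : H → T := fun p => WithLp.toLp 2 fun i : ι => Φ i.2 (dilate (2 ^ (i.1 : ℕ))⁻¹ p)
  refine ⟨fun p => e (F p), (792 * A)⁻¹, by positivity, fun p p' => ?_⟩
  rw [← map_sub, LinearIsometryEquiv.norm_map]
  constructor
  · rcases eq_or_ne p p' with rfl | hne
    · rw [ccDist_self, Real.zero_rpow (by linarith), mul_zero]
      positivity
    · have hd := ccDist_pos hne
      obtain ⟨n, hn1, hn2⟩ := exists_mem_Ico_zpow (div_pos hd (by norm_num : (0 : ℝ) < 99))
        (one_lt_two : (1 : ℝ) < 2)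
      rw [zpow_add_one₀ two_ne_zero] at hn2
      have hMZ : (0 : ℤ) < M := by exact_mod_cast hM0
      have hi0 := Int.emod_nonneg n hMZ.ne'
      have hi1 := Int.emod_lt_of_pos n hMZ
      obtain ⟨i, hi⟩ : ∃ i : Fin M, ((i : ℕ) : ℤ) = n % M :=
        ⟨⟨(n % M).toNat, by omega⟩, by simpa using hi0⟩
      have hpow : A ^ (n / M) * 2 ^ (i : ℕ) = (2 : ℝ) ^ n := by
        rw [hA, ← zpow_natCast, ← zpow_natCast, ← zpow_mul, ← zpow_add₀ two_ne_zero, hi,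
          Int.mul_ediv_add_emod]
      obtain ⟨k, hk⟩ := exists_latticeClass m (dilate ((2 : ℝ) ^ n)⁻¹ p)
      have hdil (q : H) : dilate (A ^ (n / M))⁻¹ (dilate (2 ^ (i : ℕ))⁻¹ q) =
          dilate ((2 : ℝ) ^ n)⁻¹ q := by
        rw [dilate_dilate, ← mul_inv, hpow]
      have htest : IsTestPair (latticeClass k) (dilate (A ^ (n / M))⁻¹ (dilate (2 ^ (i : ℕ))⁻¹ p))
          (dilate (A ^ (n / M))⁻¹ (dilate (2 ^ (i : ℕ))⁻¹ p')) := by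
        have h2 : (0 : ℝ) < 2 ^ n := by positivity
        rw [hdil, hdil]
        refine ⟨hk, ?_, ?_⟩ <;> rw [ccDist_dilate (inv_pos.2 h2)]
        · rw [le_inv_mul_iff₀ h2]
          linarith
        · rw [inv_mul_le_iff₀ h2]
          linarith
      have h1 := hl k _ _ _ htest
      have h2 : ‖(F p - F p') (i, k)‖ ≤ ‖F p - F p'‖ := PiLp.norm_apply_le _ _
      refine le_trans ?_ (h1.trans h2)
      have h3 : ccDist p p' ≤ (198 * A) * A ^ (n / M) := by
        have : (2 : ℝ) ^ (i : ℕ) ≤ A := pow_le_pow_right₀ one_le_two i.2.le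
        have : A ^ (n / M) * 2 ^ (i : ℕ) ≤ A ^ (n / M) * A := by gcongr
        linarith
      have h4 : ccDist p p' ^ (1 - ε) ≤ (198 * A) * (A ^ (n / M)) ^ (1 - ε) := by
        refine (Real.rpow_le_rpow hd.le h3 (by linarith)).trans ?_
        rw [Real.mul_rpow (by positivity) (by positivity)]
        gcongr
        exact Real.rpow_le_self_of_one_le (by linarith) (by linarith)
      rw [inv_mul_le_iff₀ (by positivity)]
      linarith
  · set s : ℝ := ε ^ (-(1 / 2 : ℝ))
    set t : ℝ := ccDist p p' ^ (1 - ε) with ht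
    have ht0 : 0 ≤ t := Real.rpow_nonneg (ccDist_nonneg _ _) _
    have h1 (i : ι) : ‖(F p - F p') i‖ ≤ (2 * C * A + 2) * s * t := by
      refine (hu i.2 _ _).trans ?_
      gcongr
      rw [ht, ccDist_dilate (by positivity)]
      refine Real.rpow_le_rpow (mul_nonneg (by positivity) (ccDist_nonneg _ _)) ?_ (by linarith)
      exact mul_le_of_le_one_left (ccDist_nonneg _ _)
        (inv_le_one_of_one_le₀ (one_le_pow₀ one_le_two))
    have h2 : ‖F p - F p'‖ ≤ Q * s * t := by
      refine (norm_piLp_le_sum _).trans ((Finset.sum_le_sum fun i _ => h1 i).trans_eq ?_)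
      rw [Finset.sum_const, nsmul_eq_mul, Finset.card_univ]
      ring
    refine h2.trans ?_
    gcongr
    rw [mul_add, ← mul_assoc, inv_mul_cancel₀ (by positivity), one_mul]
    exact le_add_of_nonneg_right (by positivity)
end
end

section
/- There exist a constant c > 0, constants C_j > 0 for each integer j ≥ 0, and a smooth map φ⁰: H → ℝ^{20} such that ‖φ⁰‖_{C^j} ≤ C_j for every integer j ≥ 0, and for every p ∈ H the wedge product of the six vectors Wφ⁰(p), W ∈ {X, Y, Z, XX, YY, XY}, satisfies |⋀_{W = X,Y,Z,XX,YY,XY} Wφ⁰(p)| ≥ c. -/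
open scoped ENNReal NNReal RealInnerProductSpace BigOperators

noncomputable section

open Heisenberg

open scoped ContDiff

namespace Heisenberg

/-- A real plane wave in the horizontal coordinates of `H`. -/
def planeWave (r a b β : ℝ) (p : H) : ℝ := r * Real.cos (a * p.1 + b * p.2.1 + β)

/-- On the slab where `y - c` is closest to the integer `n`, the wave `cos (z - n x + β)` modulated
by the profile `g (y - c - n)`. -/
def modulatedWave (c : ℝ) (g : ℝ → ℝ) (β : ℝ) (p : H) : ℝ :=
  g (p.2.1 - c - round (p.2.1 - c)) * Real.cos (p.2.2 - round (p.2.1 - c) * p.1 + β)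

/-- A class of bounded smooth functions on `H` that is stable under `X` and `Y`. -/
inductive Wave : (H → ℝ) → Prop
  | plane (r a b β : ℝ) : Wave (planeWave r a b β)
  | modulated (c : ℝ) (g : ℝ → ℝ) (β : ℝ) (hg : ContDiff ℝ ∞ g)
      (hsupp : tsupport g ⊆ Metric.closedBall 0 (3 / 8)) : Wave (modulatedWave c g β)

theorem fderiv_apply_eq_of_hasDerivAt {f : H → ℝ} {p v : H} {d : ℝ} (hf : DifferentiableAt ℝ f p)
    (h : HasDerivAt (fun t : ℝ => f (p + t • v)) d 0) : fderiv ℝ f p v = d :=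
  (hf.hasFDerivAt.hasLineDerivAt v).unique h

theorem contDiff_planeWave (r a b β : ℝ) : ContDiff ℝ ∞ (planeWave r a b β) := by
  unfold planeWave
  fun_prop

theorem fderiv_planeWave (r a b β : ℝ) (p v : H) :
    fderiv ℝ (planeWave r a b β) p v =
      planeWave (r * (a * v.1 + b * v.2.1)) a b (β + Real.pi / 2) p := by
  refine fderiv_apply_eq_of_hasDerivAt
    ((contDiff_planeWave r a b β).differentiable (by simp)).differentiableAt ?_
  have h : HasDerivAt (fun t : ℝ => a * (p.1 + t * v.1) + b * (p.2.1 + t * v.2.1) + β)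
      (a * v.1 + b * v.2.1) 0 := by
    have h₁ := (((hasDerivAt_id (0 : ℝ)).mul_const v.1).const_add p.1).const_mul a
    have h₂ := (((hasDerivAt_id (0 : ℝ)).mul_const v.2.1).const_add p.2.1).const_mul b
    simpa using (h₁.add h₂).add_const β
  refine (h.cos.const_mul r).congr_deriv ?_
  rw [planeWave, ← add_assoc, Real.cos_add_pi_div_two]
  simp only [zero_mul, add_zero]
  ring

theorem XD_planeWave (r a b β : ℝ) :
    XD (planeWave r a b β) = planeWave (r * a) a b (β + Real.pi / 2) := by
  ext p
  simp [XD, fderiv_planeWave]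

theorem YD_planeWave (r a b β : ℝ) :
    YD (planeWave r a b β) = planeWave (r * b) a b (β + Real.pi / 2) := by
  ext p
  simp [YD, fderiv_planeWave]

theorem ZD_planeWave (r a b β : ℝ) (p : H) : ZD (planeWave r a b β) p = 0 := by
  simp [ZD, fderiv_planeWave, planeWave]

section Modulated

variable {g : ℝ → ℝ}

theorem modulatedWave_eventuallyEq (hsupp : tsupport g ⊆ Metric.closedBall 0 (3 / 8))
    (c β : ℝ) (p : H) :
    modulatedWave c g β =ᶠ[nhds p] fun q : H =>
      g (q.2.1 - c - round (p.2.1 - c)) * Real.cos (q.2.2 - round (p.2.1 - c) * q.1 + β) := by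
  have hzero : ∀ u : ℝ, 3 / 8 < |u| → g u = 0 := fun u hu =>
    image_eq_zero_of_notMem_tsupport fun hmem => by
      have := hsupp hmem
      rw [mem_closedBall_zero_iff, Real.norm_eq_abs] at this
      linarith
  have hnear : ∀ᶠ q : H in nhds p, |q.2.1 - p.2.1| < 1 / 16 := by
    have hcont : Continuous fun q : H => |q.2.1 - p.2.1| := by fun_prop
    exact hcont.continuousAt.eventually_lt continuousAt_const (by simp)
  filter_upwards [hnear] with q hq
  unfold modulatedWave
  have hp := abs_sub_round (p.2.1 - c)
  have hq' := abs_sub_round (q.2.1 - c)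
  set n := round (p.2.1 - c)
  set m := round (q.2.1 - c)
  by_cases hmn : m = n
  · rw [hmn]
  have hdist : (1 : ℝ) ≤ |(m : ℝ) - n| := by
    exact_mod_cast Int.one_le_abs (sub_ne_zero.mpr hmn)
  have hfar : 3 / 8 < |q.2.1 - c - m| ∧ 3 / 8 < |q.2.1 - c - n| := by
    rw [abs_le] at hp hq'
    rw [abs_lt] at hq
    rw [lt_abs, lt_abs]
    rcases le_abs.mp hdist with h | h
    · exact ⟨Or.inr (by linarith), Or.inl (by linarith)⟩
    · exact ⟨Or.inl (by linarith), Or.inr (by linarith)⟩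
  rw [hzero _ hfar.1, hzero _ hfar.2, zero_mul, zero_mul]

theorem contDiff_modulatedWave (hg : ContDiff ℝ ∞ g)
    (hsupp : tsupport g ⊆ Metric.closedBall 0 (3 / 8)) (c β : ℝ) :
    ContDiff ℝ ∞ (modulatedWave c g β) := by
  rw [contDiff_iff_contDiffAt]
  intro p
  refine ContDiffAt.congr_of_eventuallyEq ?_ (modulatedWave_eventuallyEq hsupp c β p)
  exact ContDiff.contDiffAt (by fun_prop)

theorem fderiv_modulatedWave (hg : ContDiff ℝ ∞ g)
    (hsupp : tsupport g ⊆ Metric.closedBall 0 (3 / 8)) (c β : ℝ) (p v : H) :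
    fderiv ℝ (modulatedWave c g β) p v =
      v.2.1 * modulatedWave c (deriv g) β p +
        (v.2.2 - round (p.2.1 - c) * v.1) * modulatedWave c g (β + Real.pi / 2) p := by
  rw [(modulatedWave_eventuallyEq hsupp c β p).fderiv_eq]
  refine fderiv_apply_eq_of_hasDerivAt
    (ContDiff.differentiable (n := ∞) (by fun_prop) (by simp)).differentiableAt ?_
  unfold modulatedWave
  generalize ((round (p.2.1 - c) : ℤ) : ℝ) = n
  have h₁ : HasDerivAt (fun t : ℝ => p.2.1 + t * v.2.1 - c - n) v.2.1 0 := by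
    simpa using
      ((((hasDerivAt_id (0 : ℝ)).mul_const v.2.1).const_add p.2.1).sub_const c).sub_const n
  have h₂ : HasDerivAt (fun t : ℝ => p.2.2 + t * v.2.2 - n * (p.1 + t * v.1) + β)
      (v.2.2 - n * v.1) 0 := by
    have h₃ := (((hasDerivAt_id (0 : ℝ)).mul_const v.1).const_add p.1).const_mul n
    have h₄ := ((hasDerivAt_id (0 : ℝ)).mul_const v.2.2).const_add p.2.2
    simpa using (h₄.sub h₃).add_const β
  have hg' : HasDerivAt g (deriv g (p.2.1 + 0 * v.2.1 - c - n)) (p.2.1 + 0 * v.2.1 - c - n) :=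
    (hg.differentiable (by simp)).differentiableAt.hasDerivAt
  refine ((hg'.comp (0 : ℝ) h₁).mul h₂.cos).congr_deriv ?_
  rw [← add_assoc, Real.cos_add_pi_div_two]
  simp only [Function.comp_apply, zero_mul, add_zero]
  ring

theorem XD_modulatedWave (hg : ContDiff ℝ ∞ g)
    (hsupp : tsupport g ⊆ Metric.closedBall 0 (3 / 8)) (c β : ℝ) :
    XD (modulatedWave c g β) = modulatedWave c (fun u => (u + c) * g u) (β + Real.pi / 2) := by
  ext p
  rw [XD, fderiv_modulatedWave hg hsupp]
  simp only [modulatedWave]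
  ring

theorem YD_modulatedWave (hg : ContDiff ℝ ∞ g)
    (hsupp : tsupport g ⊆ Metric.closedBall 0 (3 / 8)) (c β : ℝ) :
    YD (modulatedWave c g β) = modulatedWave c (deriv g) β := by
  ext p
  rw [YD, fderiv_modulatedWave hg hsupp]
  simp

theorem ZD_modulatedWave (hg : ContDiff ℝ ∞ g)
    (hsupp : tsupport g ⊆ Metric.closedBall 0 (3 / 8)) (c β : ℝ) :
    ZD (modulatedWave c g β) = modulatedWave c g (β + Real.pi / 2) := by
  ext p
  rw [ZD, fderiv_modulatedWave hg hsupp]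
  simp

end Modulated

namespace Wave

variable {f : H → ℝ}

theorem contDiff (hf : Wave f) : ContDiff ℝ ∞ f := by
  cases hf with
  | plane r a b β => exact contDiff_planeWave r a b β
  | modulated c g β hg hsupp => exact contDiff_modulatedWave hg hsupp c β

theorem XD (hf : Wave f) : Wave (XD f) := by
  cases hf with
  | plane r a b β => rw [XD_planeWave]; exact plane _ _ _ _
  | modulated c g β hg hsupp =>
    rw [XD_modulatedWave hg hsupp]
    exact modulated _ _ _ (by fun_prop) (tsupport_mul_subset_right.trans hsupp)

theorem YD (hf : Wave f) : Wave (YD f) := by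
  cases hf with
  | plane r a b β => rw [YD_planeWave]; exact plane _ _ _ _
  | modulated c g β hg hsupp =>
    rw [YD_modulatedWave hg hsupp]
    exact modulated _ _ _ (ContDiff.deriv' (n := ∞) (by simpa using hg))
      (tsupport_deriv_subset.trans hsupp)

theorem exists_bound (hf : Wave f) : ∃ C, ∀ p, |f p| ≤ C := by
  cases hf with
  | plane r a b β =>
    refine ⟨|r|, fun p => ?_⟩
    rw [planeWave, abs_mul]
    exact mul_le_of_le_one_right (abs_nonneg _) (Real.abs_cos_le_one _)
  | modulated c g β hg hsupp =>
    have hcomp : HasCompactSupport g :=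
      (isCompact_closedBall (0 : ℝ) (3 / 8)).of_isClosed_subset (isClosed_tsupport g) hsupp
    obtain ⟨C, hC⟩ := hg.continuous.bounded_above_of_compact_support hcomp
    refine ⟨C, fun p => ?_⟩
    rw [modulatedWave, abs_mul]
    exact (mul_le_of_le_one_right (abs_nonneg _) (Real.abs_cos_le_one _)).trans (hC _)

end Wave

section Components

variable {D : ℕ} {φ : H → EuclideanSpace ℝ (Fin D)}

theorem fderiv_component (hφ : ContDiff ℝ ∞ φ) (p v : H) (i : Fin D) :
    fderiv ℝ φ p v i = fderiv ℝ (fun q => φ q i) p v := by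
  have h := (EuclideanSpace.proj (𝕜 := ℝ) i).hasFDerivAt.comp p
    ((hφ.differentiable (by simp)).differentiableAt (x := p)).hasFDerivAt
  exact (congrArg (fun L => L v) h.fderiv).symm

/-- A vector-valued function on `H` all of whose components are waves. -/
def VectorWave (φ : H → EuclideanSpace ℝ (Fin D)) : Prop := ∀ i, Wave fun p => φ p i

namespace VectorWave

theorem contDiff (hφ : VectorWave φ) : ContDiff ℝ ∞ φ :=
  contDiff_euclidean.mpr fun i => (hφ i).contDiff

theorem XD_apply (hφ : VectorWave φ) (p : H) (i : Fin D) :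
    XD φ p i = XD (fun q => φ q i) p :=
  fderiv_component hφ.contDiff _ _ _

theorem YD_apply (hφ : VectorWave φ) (p : H) (i : Fin D) :
    YD φ p i = YD (fun q => φ q i) p :=
  fderiv_component hφ.contDiff _ _ _

theorem ZD_apply (hφ : VectorWave φ) (p : H) (i : Fin D) :
    ZD φ p i = ZD (fun q => φ q i) p :=
  fderiv_component hφ.contDiff _ _ _

theorem XD (hφ : VectorWave φ) : VectorWave (XD φ) := fun i => by
  simpa only [hφ.XD_apply] using (hφ i).XD

theorem YD (hφ : VectorWave φ) : VectorWave (YD φ) := fun i => by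
  simpa only [hφ.YD_apply] using (hφ i).YD

theorem foldr_WD (hφ : VectorWave φ) (l : List Bool) : VectorWave (l.foldr WD φ) := by
  induction l with
  | nil => exact hφ
  | cons b l ih =>
    cases b
    · exact ih.YD
    · exact ih.XD

theorem exists_bound (hφ : VectorWave φ) : ∃ C, 0 ≤ C ∧ ∀ p, ‖φ p‖ ≤ C := by
  choose C hC using fun i => (hφ i).exists_bound
  refine ⟨√(∑ i, C i ^ 2), Real.sqrt_nonneg _, fun p => ?_⟩
  rw [EuclideanSpace.norm_eq]
  gcongr with i
  exact hC i p

theorem exists_gradNorm_bound (hφ : VectorWave φ) (j : ℕ) :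
    ∃ C, 0 ≤ C ∧ ∀ p, gradNorm j φ p ≤ C := by
  choose C _ hC using fun w : Fin j → Bool => (hφ.foldr_WD (List.ofFn w)).exists_bound
  refine ⟨√(∑ w, C w ^ 2), Real.sqrt_nonneg _, fun p => ?_⟩
  unfold gradNorm
  gcongr with w
  exact hC w p

theorem exists_CkR_bound (hφ : VectorWave φ) (k : ℕ) :
    ∃ C, 0 < C ∧ CkR k 1 φ ≤ ENNReal.ofReal C := by
  choose C hC₀ hC using hφ.exists_gradNorm_bound
  refine ⟨∑ j ∈ Finset.range (k + 1), C j + 1,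
    add_pos_of_nonneg_of_pos (Finset.sum_nonneg fun j _ => hC₀ j) one_pos, ?_⟩
  calc CkR k 1 φ ≤ ∑ j ∈ Finset.range (k + 1), ENNReal.ofReal (C j) := by
        refine Finset.sum_le_sum fun j _ => ?_
        simp only [one_pow, ENNReal.ofReal_one, one_mul, zero_add]
        exact iSup_le fun p => ENNReal.ofReal_le_ofReal (hC j p)
    _ = ENNReal.ofReal (∑ j ∈ Finset.range (k + 1), C j) :=
        (ENNReal.ofReal_sum_of_nonneg fun j _ => hC₀ j).symm
    _ ≤ _ := ENNReal.ofReal_le_ofReal (by linarith)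

end VectorWave

end Components

/-- A lower bound on the Gram quadratic form bounds the wedge product from below. -/
theorem le_wedgeNorm {D k : ℕ} {v : Fin k → EuclideanSpace ℝ (Fin D)} {lam : ℝ} (hlam : 0 ≤ lam)
    (h : ∀ a : Fin k → ℝ, lam * ∑ i, a i ^ 2 ≤ ‖∑ i, a i • v i‖ ^ 2) :
    √(lam ^ k) ≤ wedgeNorm v := by
  refine Real.sqrt_le_sqrt ?_
  have hG := Matrix.isHermitian_gram ℝ v
  change lam ^ k ≤ (Matrix.gram ℝ v).det
  rw [hG.det_eq_prod_eigenvalues]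
  calc lam ^ k = ∏ _i : Fin k, lam := by simp
    _ ≤ ∏ i, hG.eigenvalues i := by
      refine Finset.prod_le_prod (fun _ _ => hlam) fun i _ => ?_
      have hunit : ∑ j, hG.eigenvectorBasis i j ^ 2 = 1 := by
        rw [← EuclideanSpace.real_norm_sq_eq, hG.eigenvectorBasis.orthonormal.1 i, one_pow]
      have hi := h (hG.eigenvectorBasis i)
      rw [hunit, mul_one, ← real_inner_self_eq_norm_sq,
        ← Matrix.star_dotProduct_gram_mulVec] at hi
      rw [hG.eigenvalues_eq]
      exact hi
    _ = _ := rfl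

/-- A smooth profile equal to `1` on `[-1/4, 1/4]` and supported in `[-3/8, 3/8]`. -/
def profile : ContDiffBump (0 : ℝ) := ⟨1 / 4, 3 / 8, by norm_num, by norm_num⟩

theorem contDiff_profile : ContDiff ℝ ∞ profile := profile.contDiff

theorem tsupport_profile : tsupport profile ⊆ Metric.closedBall 0 (3 / 8) :=
  profile.tsupport_eq.subset

theorem profile_eq_one {u : ℝ} (hu : |u| ≤ 1 / 4) : profile u = 1 :=
  profile.one_of_mem_closedBall (by simpa [profile] using hu)

theorem exists_abs_sub_round_le (y : ℝ) :
    |y - 0 - round (y - 0)| ≤ 1 / 4 ∨ |y - 1 / 2 - round (y - 1 / 2)| ≤ 1 / 4 := by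
  have h₀ := abs_le.mp (abs_sub_round (y - 0))
  have h₁ := abs_le.mp (abs_sub_round (y - 1 / 2))
  set n := round (y - 0)
  set m := round (y - 1 / 2)
  by_contra! hlt
  obtain ⟨hn, hm⟩ := hlt
  have hcast : ((m - n : ℤ) : ℝ) = m - n := by push_cast; ring
  have hcases : m - n ≤ -2 ∨ m - n = -1 ∨ m - n = 0 ∨ 1 ≤ m - n := by omega
  have hcases' : (m : ℝ) - n ≤ -2 ∨ (m : ℝ) - n = -1 ∨ (m : ℝ) - n = 0 ∨ 1 ≤ (m : ℝ) - n := by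
    rw [← hcast]
    exact_mod_cast hcases
  rw [lt_abs] at hn hm
  rcases hcases' with h | h | h | h <;> rcases hn with hn | hn <;>
    rcases hm with hm | hm <;> linarith

/-- Some quarter-turn pair of modulated waves has a `Z`-derivative bounded away from zero. -/
theorem exists_modulatedWave_sq_ge (p : H) :
    ∃ c ∈ ({0, 1 / 2} : Set ℝ), ∃ β ∈ ({0, Real.pi / 2} : Set ℝ),
      1 / 2 ≤ ZD (modulatedWave c profile β) p ^ 2 := by
  simp only [ZD_modulatedWave contDiff_profile tsupport_profile]
  obtain ⟨c, hc, hu⟩ : ∃ c ∈ ({0, 1 / 2} : Set ℝ), |p.2.1 - c - round (p.2.1 - c)| ≤ 1 / 4 := by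
    rcases exists_abs_sub_round_le p.2.1 with h | h
    · exact ⟨0, by simp, h⟩
    · exact ⟨1 / 2, by simp, h⟩
  refine ⟨c, hc, ?_⟩
  simp only [modulatedWave, profile_eq_one hu, one_mul]
  set θ := p.2.2 - round (p.2.1 - c) * p.1
  have hsq := Real.sin_sq_add_cos_sq θ
  rcases le_total (1 / 2) (Real.sin θ ^ 2) with h | h
  · refine ⟨0, by simp, ?_⟩
    rw [zero_add, Real.cos_add_pi_div_two]
    linarith [neg_sq (Real.sin θ)]
  · refine ⟨Real.pi / 2, by simp, ?_⟩
    rw [add_halves, Real.cos_add_pi]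
    linarith [neg_sq (Real.cos θ)]

/-- The components of a locally free map `H → ℝ²⁰`; the last ten vanish. -/
def oscillatingComponent : Fin 20 → H → ℝ :=
  ![planeWave 1 1 0 0, planeWave 1 1 0 (Real.pi / 2),
    planeWave 1 0 1 0, planeWave 1 0 1 (Real.pi / 2),
    planeWave 1 1 1 0, planeWave 1 1 1 (Real.pi / 2),
    modulatedWave 0 profile 0, modulatedWave 0 profile (Real.pi / 2),
    modulatedWave (1 / 2) profile 0, modulatedWave (1 / 2) profile (Real.pi / 2),
    planeWave 0 0 0 0, planeWave 0 0 0 0, planeWave 0 0 0 0, planeWave 0 0 0 0,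
    planeWave 0 0 0 0, planeWave 0 0 0 0, planeWave 0 0 0 0, planeWave 0 0 0 0,
    planeWave 0 0 0 0, planeWave 0 0 0 0]

/-- A locally free map `H → ℝ²⁰` made of waves. -/
def oscillatingMap (p : H) : EuclideanSpace ℝ (Fin 20) :=
  WithLp.toLp 2 fun i => oscillatingComponent i p

theorem vectorWave_oscillatingMap : VectorWave oscillatingMap := by
  intro i
  change Wave (oscillatingComponent i)
  fin_cases i
  all_goals first
    | exact Wave.plane _ _ _ _
    | exact Wave.modulated _ _ _ contDiff_profile tsupport_profile

/-- The combination of `X, Y, Z, XX, YY, XY` with coefficients `a`, applied to `φ` at `p`. -/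
def jetCombination {E : Type*} [NormedAddCommGroup E] [NormedSpace ℝ E] (a : Fin 6 → ℝ)
    (φ : H → E) (p : H) : E :=
  a 0 • XD φ p + a 1 • YD φ p + a 2 • ZD φ p + a 3 • XD (XD φ) p + a 4 • YD (YD φ) p +
    a 5 • XD (YD φ) p

theorem VectorWave.jetCombination_apply {D : ℕ} {φ : H → EuclideanSpace ℝ (Fin D)}
    (hφ : VectorWave φ) (a : Fin 6 → ℝ) (p : H) (i : Fin D) :
    jetCombination a φ p i = jetCombination a (fun q => φ q i) p := by
  simp only [jetCombination, PiLp.add_apply, PiLp.smul_apply, hφ.XD.XD_apply, hφ.YD.YD_apply,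
    hφ.YD.XD_apply, hφ.XD_apply, hφ.YD_apply, hφ.ZD_apply]

theorem jetCombination_planeWave_sq_add_sq (a : Fin 6 → ℝ) (r s : ℝ) (p : H) :
    jetCombination a (planeWave 1 r s 0) p ^ 2 +
        jetCombination a (planeWave 1 r s (Real.pi / 2)) p ^ 2 =
      (a 0 * r + a 1 * s) ^ 2 + (a 3 * r ^ 2 + a 4 * s ^ 2 + a 5 * (r * s)) ^ 2 := by
  simp only [jetCombination, XD_planeWave, YD_planeWave, ZD_planeWave, planeWave, smul_eq_mul,
    ← add_assoc, add_zero, Real.cos_add_pi_div_two, Real.sin_add_pi_div_two]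
  set θ := r * p.1 + s * p.2.1
  have hsq := Real.sin_sq_add_cos_sq θ
  linear_combination ((a 0 * r + a 1 * s) ^ 2 +
    (a 3 * r ^ 2 + a 4 * s ^ 2 + a 5 * (r * s)) ^ 2) * hsq

theorem exists_jet_bound {D : ℕ} {φ : H → EuclideanSpace ℝ (Fin D)}
    (hφ : VectorWave φ) : ∃ M, 0 ≤ M ∧ ∀ p i,
      XD (fun q => φ q i) p ^ 2 ≤ M ∧ YD (fun q => φ q i) p ^ 2 ≤ M ∧
      XD (XD fun q => φ q i) p ^ 2 ≤ M ∧ YD (YD fun q => φ q i) p ^ 2 ≤ M ∧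
      XD (YD fun q => φ q i) p ^ 2 ≤ M := by
  have hcomp : ∀ {ψ : H → EuclideanSpace ℝ (Fin D)}, VectorWave ψ →
      ∃ M, 0 ≤ M ∧ ∀ p i, ψ p i ^ 2 ≤ M := by
    intro ψ hψ
    obtain ⟨C, -, hC⟩ := hψ.exists_bound
    refine ⟨C ^ 2, sq_nonneg _, fun p i => ?_⟩
    rw [← sq_abs]
    gcongr
    exact (PiLp.norm_apply_le (ψ p) i).trans (hC p)
  obtain ⟨M₁, h₁, H₁⟩ := hcomp hφ.XD
  obtain ⟨M₂, h₂, H₂⟩ := hcomp hφ.YD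
  obtain ⟨M₃, h₃, H₃⟩ := hcomp hφ.XD.XD
  obtain ⟨M₄, h₄, H₄⟩ := hcomp hφ.YD.YD
  obtain ⟨M₅, h₅, H₅⟩ := hcomp hφ.YD.XD
  simp only [hφ.XD.XD_apply, hφ.YD.YD_apply, hφ.YD.XD_apply, hφ.XD_apply, hφ.YD_apply]
    at H₁ H₂ H₃ H₄ H₅
  refine ⟨M₁ + M₂ + M₃ + M₄ + M₅, by positivity, fun p i => ⟨?_, ?_, ?_, ?_, ?_⟩⟩
  · linarith [H₁ p i]
  · linarith [H₂ p i]
  · linarith [H₃ p i]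
  · linarith [H₄ p i]
  · linarith [H₅ p i]

theorem sq_add_six_le (u x y s t w : ℝ) :
    (u - x - y - s - t - w) ^ 2 ≤ 6 * (u ^ 2 + x ^ 2 + y ^ 2 + s ^ 2 + t ^ 2 + w ^ 2) := by
  linarith [sq_nonneg (u + x), sq_nonneg (u + y), sq_nonneg (u + s), sq_nonneg (u + t), sq_nonneg (u + w),
    sq_nonneg (x - y), sq_nonneg (x - s), sq_nonneg (x - t), sq_nonneg (x - w), sq_nonneg (y - s),
    sq_nonneg (y - t), sq_nonneg (y - w), sq_nonneg (s - t), sq_nonneg (s - w), sq_nonneg (t - w)]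

theorem exists_jetCombination_lower_bound :
    ∃ K, 0 < K ∧ ∀ (a : Fin 6 → ℝ) (p : H),
      ∑ i, a i ^ 2 ≤ K * ‖jetCombination a oscillatingMap p‖ ^ 2 := by
  obtain ⟨M, hM, hjet⟩ := exists_jet_bound vectorWave_oscillatingMap
  refine ⟨22 + 12 * (1 + 22 * M), by positivity, fun a p => ?_⟩
  set N := ‖jetCombination a oscillatingMap p‖ with hN
  have hle : ∀ i, jetCombination a (oscillatingComponent i) p ^ 2 ≤ N ^ 2 := by
    intro i
    have h := PiLp.norm_apply_le (jetCombination a oscillatingMap p) i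
    rw [vectorWave_oscillatingMap.jetCombination_apply] at h
    rw [← sq_abs]
    gcongr
    exact h
  have hx := jetCombination_planeWave_sq_add_sq a 1 0 p
  have hy := jetCombination_planeWave_sq_add_sq a 0 1 p
  have hxy := jetCombination_planeWave_sq_add_sq a 1 1 p
  have e0 : jetCombination a (planeWave 1 1 0 0) p ^ 2 ≤ N ^ 2 := hle 0
  have e1 : jetCombination a (planeWave 1 1 0 (Real.pi / 2)) p ^ 2 ≤ N ^ 2 := hle 1
  have e2 : jetCombination a (planeWave 1 0 1 0) p ^ 2 ≤ N ^ 2 := hle 2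
  have e3 : jetCombination a (planeWave 1 0 1 (Real.pi / 2)) p ^ 2 ≤ N ^ 2 := hle 3
  have e4 : jetCombination a (planeWave 1 1 1 0) p ^ 2 ≤ N ^ 2 := hle 4
  have e5 : jetCombination a (planeWave 1 1 1 (Real.pi / 2)) p ^ 2 ≤ N ^ 2 := hle 5
  have bx : a 0 ^ 2 + a 3 ^ 2 ≤ 2 * N ^ 2 := by linarith
  have bY : a 1 ^ 2 + a 4 ^ 2 ≤ 2 * N ^ 2 := by linarith
  have bxy : (a 3 + a 4 + a 5) ^ 2 ≤ 2 * N ^ 2 := by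
    nlinarith [sq_nonneg (a 0 + a 1)]
  have b5 : a 5 ^ 2 ≤ 18 * N ^ 2 := by
    nlinarith [sq_nonneg (a 3 - a 4), sq_nonneg (a 3 + a 4 + a 5 + a 3),
      sq_nonneg (a 3 + a 4 + a 5 + a 4), sq_nonneg (a 0), sq_nonneg (a 1)]
  obtain ⟨i, hi⟩ : ∃ i, 1 / 2 ≤ ZD (oscillatingComponent i) p ^ 2 := by
    obtain ⟨c, hc, β, hβ, h⟩ := exists_modulatedWave_sq_ge p
    rcases hc with rfl | rfl <;> rcases hβ with rfl | rfl
    · exact ⟨6, h⟩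
    · exact ⟨7, h⟩
    · exact ⟨8, h⟩
    · exact ⟨9, h⟩
  obtain ⟨j1, j2, j3, j4, j5⟩ := hjet p i
  have hu := hle i
  change XD (oscillatingComponent i) p ^ 2 ≤ M at j1
  change YD (oscillatingComponent i) p ^ 2 ≤ M at j2
  change XD (XD (oscillatingComponent i)) p ^ 2 ≤ M at j3
  change YD (YD (oscillatingComponent i)) p ^ 2 ≤ M at j4
  change XD (YD (oscillatingComponent i)) p ^ 2 ≤ M at j5
  simp only [jetCombination, smul_eq_mul] at hu
  generalize XD (oscillatingComponent i) p = x at *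
  generalize YD (oscillatingComponent i) p = y at *
  generalize ZD (oscillatingComponent i) p = z at *
  generalize XD (XD (oscillatingComponent i)) p = s at *
  generalize YD (YD (oscillatingComponent i)) p = t at *
  generalize XD (YD (oscillatingComponent i)) p = w at *
  have hz := sq_add_six_le (a 0 * x + a 1 * y + a 2 * z + a 3 * s + a 4 * t + a 5 * w)
    (a 0 * x) (a 1 * y) (a 3 * s) (a 4 * t) (a 5 * w)
  have m1 := mul_le_mul_of_nonneg_left j1 (sq_nonneg (a 0))
  have m2 := mul_le_mul_of_nonneg_left j2 (sq_nonneg (a 1))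
  have m3 := mul_le_mul_of_nonneg_left j3 (sq_nonneg (a 3))
  have m4 := mul_le_mul_of_nonneg_left j4 (sq_nonneg (a 4))
  have m5 := mul_le_mul_of_nonneg_left j5 (sq_nonneg (a 5))
  have hsum : (a 0 ^ 2 + a 3 ^ 2 + (a 1 ^ 2 + a 4 ^ 2) + a 5 ^ 2) * M ≤ 22 * N ^ 2 * M := by
    gcongr
    linarith
  have hz' : a 2 ^ 2 * (1 / 2) ≤ a 2 ^ 2 * z ^ 2 := by gcongr
  have b2 : a 2 ^ 2 ≤ 12 * (1 + 22 * M) * N ^ 2 := by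
    ring_nf at hz hu hz' hsum m1 m2 m3 m4 m5 ⊢
    linarith
  rw [Fin.sum_univ_six]
  linarith

end Heisenberg

/-- **A single oscillating function** (Proposition 4.2 of the paper): a smooth map
`φ⁰ : H → ℝ²⁰` with all `C^j` norms bounded which is a locally free embedding. -/
theorem statement5 :
    ∃ (c : ℝ) (Cj : ℕ → ℝ) (φ : H → EuclideanSpace ℝ (Fin 20)),
      0 < c ∧ (∀ j : ℕ, 0 < Cj j) ∧ ContDiff ℝ (⊤ : ℕ∞) φ ∧
      (∀ j : ℕ, CkR j 1 φ ≤ ENNReal.ofReal (Cj j)) ∧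
      ∀ p : H,
        c ≤ wedgeNorm ![XD φ p, YD φ p, ZD φ p, XD (XD φ) p, YD (YD φ) p, XD (YD φ) p] := by
  obtain ⟨K, hK, hlow⟩ := exists_jetCombination_lower_bound
  choose C hC₀ hC using vectorWave_oscillatingMap.exists_CkR_bound
  refine ⟨√(K⁻¹ ^ 6), C, oscillatingMap, by positivity, hC₀,
    vectorWave_oscillatingMap.contDiff, hC, fun p => le_wedgeNorm (by positivity) fun a => ?_⟩
  rw [inv_mul_le_iff₀ hK]
  simpa [Fin.sum_univ_six, jetCombination] using hlow a p
end
end
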